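/- Consider a compound discrete memoryless channel with K components: finite alphabets 𝒳, 𝒮, 𝒴, channels W_k : 𝒳 → 𝒮 → PMF 𝒴 for k ∈ {1,…,K} and a state distribution P_S : PMF 𝒮, with the state sequence known non-causally at the transmitter only. Let 𝒰, 𝒱₁, …, 𝒱_K be nonempty finite sets and P : 𝒮 → PMF (𝒳 × 𝒰 × 𝒱₁ × ⋯ × 𝒱_K) any conditional input distribution; for each k define the joint pmf p_k(u,v₁,…,v_K,s,x,y) = P_S(s) · P(s)(x,u,v₁,…,v_K) · (W_k x s)(y). Then the rate R = max(0, min over nonempty subsets 𝒦 ⊆ {1,…,K} of (1/|𝒦|)·[ Σ_{k∈𝒦} I(U,V_k;Y_k) − |𝒦|·I(U;S) + H( (V_t)_{t∈𝒦} | U,S ) − Σ_{k∈𝒦} H(V_k | U) ]) is achievable, where I(U,V_k;Y_k) is computed from p_k and all quantities not involving Y are computed from the common marginal of the p_k on (u,v₁,…,v_K,s,x). -/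

import Mathlib

open scoped BigOperators

noncomputable section

namespace CompoundK

variable {𝒳 𝒮 𝒴 : Type} [Fintype 𝒳] [Fintype 𝒮] [Fintype 𝒴]

/-- Mutual information `I(A;B)` of a joint (real-valued) pmf `p` on `A × B`,
with natural logarithm and the convention `0·log(·) = 0`. -/
def mutualInfo {A B : Type} [Fintype A] [Fintype B] (p : A × B → ℝ) : ℝ :=
  ∑ a : A, ∑ b : B,
    p (a, b) *
      Real.log (p (a, b) / ((∑ b' : B, p (a, b')) * (∑ a' : A, p (a', b))))

/-- Conditional entropy `H(A|B)` of a joint pmf `p` on `A × B`: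
`H(A|B) = −Σ p(a,b)·log( p(a,b)/p_B(b) )`, which equals
`Σ_b p_B(b)·H(A|B=b)` under the convention `0·log(·) = 0`. -/
def condEntropy {A B : Type} [Fintype A] [Fintype B] (p : A × B → ℝ) : ℝ :=
  -∑ a : A, ∑ b : B, p (a, b) * Real.log (p (a, b) / (∑ a' : A, p (a', b)))

/-- Average (over i.i.d. states with pmf `PS`) error probability of message `m`
for the channel component `θ`, for the `(n,M)` code `(φ, ψ)`. -/
def avgError {Θ : Type} (W : Θ → 𝒳 → 𝒮 → PMF 𝒴) (PS : PMF 𝒮) {n M : ℕ}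
    (φ : Fin M → (Fin n → 𝒮) → (Fin n → 𝒳)) (ψ : (Fin n → 𝒴) → Fin M)
    (m : Fin M) (θ : Θ) : ℝ :=
  ∑ s : Fin n → 𝒮, (∏ i, (PS (s i)).toReal) *
    ∑ y : Fin n → 𝒴,
      (∏ i, ((W θ (φ m s i) (s i)) (y i)).toReal) * (if ψ y ≠ m then 1 else 0)

/-- `R` is an achievable rate for the compound DMC `{W θ}` with i.i.d. states
(pmf `PS`) known non-causally at the transmitter only. -/
def IsAchievable {Θ : Type} (W : Θ → 𝒳 → 𝒮 → PMF 𝒴) (PS : PMF 𝒮) (R : ℝ) : Prop :=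
  0 ≤ R ∧
    ∀ ε ∈ Set.Ioo (0 : ℝ) 1, ∀ γ ∈ Set.Ioo (0 : ℝ) 1, ∃ n₀ : ℕ, ∀ n ≥ n₀,
      ∃ M : ℕ, 1 ≤ M ∧
        ∃ (φ : Fin M → (Fin n → 𝒮) → (Fin n → 𝒳)) (ψ : (Fin n → 𝒴) → Fin M),
          Real.log M / n ≥ R - γ ∧ ∀ m θ, avgError W PS φ ψ m θ ≤ ε

set_option linter.unusedSectionVars false

lemma sum_pi_prod {ι : Type*} [Fintype ι] [DecidableEq ι] {B : ι → Type*} [∀ i, Fintype (B i)]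
    (f : ∀ i, B i → ℝ) : ∑ c : ∀ i, B i, ∏ i, f i (c i) = ∏ i, ∑ b, f i b := by
  rw [Finset.prod_univ_sum, Fintype.piFinset_univ]

open Classical in
lemma push_one {ι : Type*} [Fintype ι] [DecidableEq ι] {B V : ι → Type*} [∀ i, Fintype (B i)]
    [∀ i, Fintype (V i)]
    (ρ : ∀ i, B i → ℝ) (π : ∀ i, B i → V i) (H : (∀ i, V i) → ℝ) :
    ∑ c : ∀ i, B i, (∏ i, ρ i (c i)) * H (fun i => π i (c i)) =
      ∑ v, H v * ∏ i, ∑ b, (if π i b = v i then ρ i b else 0) := by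
  have h1 : ∀ v : ∀ i, V i, ∏ i, ∑ b, (if π i b = v i then ρ i b else 0) =
      ∑ c : ∀ i, B i, if (fun i => π i (c i)) = v then ∏ i, ρ i (c i) else 0 := by
    intro v
    rw [← sum_pi_prod]
    refine Finset.sum_congr rfl fun c _ => ?_
    rw [Finset.prod_ite_zero]
    simp [funext_iff]
  simp_rw [h1, Finset.mul_sum]
  rw [Finset.sum_comm]
  refine Finset.sum_congr rfl fun c _ => ?_
  simp [mul_comm]

open Classical in
lemma push_two {ι : Type*} [Fintype ι] [DecidableEq ι] {B V V' : ι → Type*} [∀ i, Fintype (B i)]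
    [∀ i, Fintype (V i)] [∀ i, Fintype (V' i)]
    (ρ : ∀ i, B i → ℝ) (π : ∀ i, B i → V i) (π' : ∀ i, B i → V' i)
    (H : (∀ i, V i) → (∀ i, V' i) → ℝ) :
    ∑ c : ∀ i, B i, (∏ i, ρ i (c i)) * H (fun i => π i (c i)) (fun i => π' i (c i)) =
      ∑ v, ∑ w, H v w * ∏ i, ∑ b, (if π i b = v i ∧ π' i b = w i then ρ i b else 0) := by
  have h1 : ∀ (v : ∀ i, V i) (w : ∀ i, V' i),
      ∏ i, ∑ b, (if π i b = v i ∧ π' i b = w i then ρ i b else 0) =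
      ∑ c : ∀ i, B i, if (fun i => π i (c i)) = v then
        (if (fun i => π' i (c i)) = w then ∏ i, ρ i (c i) else 0) else 0 := by
    intro v w
    rw [← sum_pi_prod]
    refine Finset.sum_congr rfl fun c _ => ?_
    rw [Finset.prod_ite_zero]
    simp [funext_iff, forall_and, ite_and]
  simp_rw [h1, Finset.mul_sum]
  have h2 : ∀ v : ∀ i, V i, ∑ w : ∀ i, V' i, ∑ c : ∀ i, B i,
      H v w * (if (fun i => π i (c i)) = v then
        (if (fun i => π' i (c i)) = w then ∏ i, ρ i (c i) else 0) else 0)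
      = ∑ c : ∀ i, B i, ∑ w : ∀ i, V' i, 
      H v w * (if (fun i => π i (c i)) = v then
        (if (fun i => π' i (c i)) = w then ∏ i, ρ i (c i) else 0) else 0) := fun v => Finset.sum_comm
  simp_rw [h2]
  rw [Finset.sum_comm]
  refine Finset.sum_congr rfl fun c _ => ?_
  have h3 : ∀ v : ∀ i, V i, ∑ w : ∀ i, V' i, 
      H v w * (if (fun i => π i (c i)) = v then
        (if (fun i => π' i (c i)) = w then ∏ i, ρ i (c i) else 0) else 0)
      = if (fun i => π i (c i)) = v then H v (fun i => π' i (c i)) * ∏ i, ρ i (c i) else 0 := by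
    intro v
    by_cases hv : (fun i => π i (c i)) = v <;> simp [hv]
  simp_rw [h3]
  simp [mul_comm]

lemma one_marg {ι B : Type*} [Fintype ι] [DecidableEq ι] [Fintype B]
    (ρ : B → ℝ) (hρ : ∑ b, ρ b = 1) (j : ι) (h : B → ℝ) :
    ∑ c : ι → B, (∏ i, ρ (c i)) * h (c j) = ∑ a, ρ a * h a := by
  have : ∀ c : ι → B, (∏ i, ρ (c i)) * h (c j) = ∏ i, (ρ (c i) * if i = j then h (c i) else 1) := by
    intro c
    rw [Finset.prod_mul_distrib]; simp
  simp_rw [this]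
  rw [sum_pi_prod (fun i b => ρ b * if i = j then h b else 1)]
  rw [Finset.prod_eq_single j]
  · simp
  · intro i _ hi; simp [hi, hρ]
  · simp

lemma total_mass {ι B : Type*} [Fintype ι] [DecidableEq ι] [Fintype B]
    (ρ : B → ℝ) (hρ : ∑ b, ρ b = 1) : ∑ c : ι → B, (∏ i, ρ (c i)) = 1 := by
  rw [sum_pi_prod (fun _ b => ρ b)]; simp [hρ]

lemma pair_prod {ι B : Type*} [Fintype ι] [DecidableEq ι] [Fintype B]
    (ρ : B → ℝ) (hρ : ∑ b, ρ b = 1) {j j' : ι} (hj : j ≠ j') (h h' : B → ℝ) :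
    ∑ c : ι → B, (∏ i, ρ (c i)) * (h (c j) * h' (c j')) =
      (∑ a, ρ a * h a) * (∑ a, ρ a * h' a) := by
  have : ∀ c : ι → B, (∏ i, ρ (c i)) * (h (c j) * h' (c j')) =
      ∏ i, (ρ (c i) * ((if i = j then h (c i) else 1) * (if i = j' then h' (c i) else 1))) := by
    intro c
    rw [Finset.prod_mul_distrib, Finset.prod_mul_distrib]; simp
  simp_rw [this]
  rw [sum_pi_prod (fun i b => ρ b * ((if i = j then h b else 1) * (if i = j' then h' b else 1)))]
  rw [Finset.prod_eq_mul j j' hj]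
  · simp [hj, hj.symm]
  · intro i _ hi; simp [hi.1, hi.2, hρ]
  · simp
  · simp

lemma pair_marg {ι B : Type*} [Fintype ι] [DecidableEq ι] [Fintype B]
    (ρ : B → ℝ) (hρ : ∑ b, ρ b = 1) {j j' : ι} (hj : j ≠ j') (h : B → B → ℝ) :
    ∑ c : ι → B, (∏ i, ρ (c i)) * h (c j) (c j') = ∑ a, ∑ b, ρ a * (ρ b * h a b) := by
  classical
  have : ∀ c : ι → B, (∏ i, ρ (c i)) * h (c j) (c j') =
      ∑ b, (∏ i, ρ (c i)) * (h (c j) b * if c j' = b then 1 else 0) := by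
    intro c; simp
  simp_rw [this]
  rw [Finset.sum_comm]
  have e : ∑ a, ∑ b, ρ a * (ρ b * h a b) = ∑ b, ∑ a, ρ a * (ρ b * h a b) := Finset.sum_comm
  rw [e]
  refine Finset.sum_congr rfl fun b _ => ?_
  rw [pair_prod ρ hρ hj (fun a => h a b) (fun b' => if b' = b then 1 else 0)]
  simp [Finset.sum_mul]
  exact Finset.sum_congr rfl fun a _ => by ring

lemma second_moment {ι B : Type*} [Fintype ι] [DecidableEq ι] [Fintype B]
    (ρ : B → ℝ) (hρ : ∑ b, ρ b = 1) (f : B → ℝ) (hf : ∑ b, ρ b * f b = 0) :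
    ∑ c : ι → B, (∏ i, ρ (c i)) * (∑ i, f (c i)) ^ 2 = Fintype.card ι * ∑ b, ρ b * f b ^ 2 := by
  have : ∀ c : ι → B, (∏ i, ρ (c i)) * (∑ i, f (c i)) ^ 2 =
      ∑ i, ∑ j, (∏ i, ρ (c i)) * (f (c i) * f (c j)) := by
    intro c
    rw [sq, Finset.sum_mul_sum, Finset.mul_sum]
    simp_rw [Finset.mul_sum]
  simp_rw [this]
  rw [Finset.sum_comm]
  have h2 : ∀ i : ι, ∑ c : ι → B, ∑ j, (∏ i, ρ (c i)) * (f (c i) * f (c j)) =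
      ∑ b, ρ b * f b ^ 2 := by
    intro i
    rw [Finset.sum_comm, Finset.sum_eq_single i]
    · rw [one_marg ρ hρ i (fun b => f b * f b)]
      simp [sq]
    · intro j _ hj
      rw [pair_prod ρ hρ hj.symm f f, hf]; simp
    · simp
  simp [h2]

/-- L1 deviation of an empirical mean. -/
lemma l1_dev {B : Type*} [Fintype B] (L : ℕ) (hL : 0 < L)
    (ρ : B → ℝ) (hρ0 : ∀ b, 0 ≤ ρ b) (hρ : ∑ b, ρ b = 1) (f : B → ℝ) (V c : ℝ) (hc : 0 < c)
    (hV : ∑ b, ρ b * f b ^ 2 ≤ V) :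
    ∑ b : Fin L → B, (∏ i, ρ (b i)) * |(∑ l, f (b l)) / L - ∑ b, ρ b * f b| ≤ c + V / (L * c) := by
  set μ := ∑ b, ρ b * f b with hμ
  have hLr : (0:ℝ) < L := by exact_mod_cast hL
  have h0 : ∑ b, ρ b * (f b - μ) = 0 := by
    simp_rw [mul_sub, Finset.sum_sub_distrib, ← Finset.sum_mul, hρ]; simp [hμ]
  have hvar : ∑ b, ρ b * (f b - μ) ^ 2 ≤ V := by
    have : ∑ b, ρ b * (f b - μ) ^ 2 = ∑ b, ρ b * f b ^ 2 - μ ^ 2 := by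
      have : ∀ b, ρ b * (f b - μ) ^ 2 = ρ b * f b ^ 2 - 2 * μ * (ρ b * f b) + μ ^ 2 * ρ b := by
        intro b; ring
      simp_rw [this, Finset.sum_add_distrib, Finset.sum_sub_distrib, ← Finset.mul_sum, hρ, ← hμ]
      ring
    nlinarith [sq_nonneg μ]
  have hm := second_moment (ι := Fin L) ρ hρ (fun b => f b - μ) h0
  have key : ∀ b : Fin L → B, (∏ i, ρ (b i)) * |(∑ l, f (b l)) / L - μ| ≤
      (∏ i, ρ (b i)) * c + (∏ i, ρ (b i)) * (∑ l, (f (b l) - μ)) ^ 2 * (1 / (L ^ 2 * c)) := by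
    intro b
    have hp : 0 ≤ ∏ i, ρ (b i) := Finset.prod_nonneg fun i _ => hρ0 _
    have e : (∑ l, (f (b l) - μ)) = L * ((∑ l, f (b l)) / L - μ) := by
      simp [Finset.sum_sub_distrib]; field_simp
    rw [mul_assoc, ← mul_add]
    refine mul_le_mul_of_nonneg_left ?_ hp
    rw [e]
    set t := (∑ l, f (b l)) / L - μ
    have : (L * t) ^ 2 * (1 / (L ^ 2 * c)) = |t| ^ 2 / c := by rw [sq_abs]; field_simp
    rw [this, ← sub_nonneg]
    have : c + |t| ^ 2 / c - |t| = ((|t| - c / 2) ^ 2 + 3 / 4 * c ^ 2) / c := by field_simp; ring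
    rw [this]; positivity
  refine (Finset.sum_le_sum fun b _ => key b).trans ?_
  rw [Finset.sum_add_distrib, ← Finset.sum_mul, ← Finset.sum_mul, total_mass ρ hρ, hm]
  simp only [Fintype.card_fin, one_mul]
  have : (L:ℝ) * ∑ b, ρ b * (f b - μ) ^ 2 * (1 / (L ^ 2 * c)) ≤ V / (L * c) := by
    rw [← Finset.sum_mul, ← mul_assoc]
    have : V / (L * c) = L * V * (1 / (L ^ 2 * c)) := by field_simp
    rw [this]; gcongr
  rw [← Finset.sum_mul] at this
  rw [mul_assoc]
  linarith

open Classical in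
theorem code_exists {X S Y ι B : Type*} [Fintype X] [Fintype S] [Fintype Y] [Fintype ι] [Fintype B]
    [Nonempty X] (ρ : B → ℝ) (hρ0 : ∀ b, 0 ≤ ρ b) (hρ1 : ∑ b, ρ b = 1)
    (PS : S → ℝ) (W : ι → X → S → Y → ℝ)
    (hW0 : ∀ k x s y, 0 ≤ W k x s y) (hW1 : ∀ k x s, ∑ y, W k x s y = 1)
    (a : B → S → X → ℝ) (ha0 : ∀ b s x, 0 ≤ a b s x) (mt : B → Y → Prop) (c1 μ : ℝ) (κ : ι → ℝ)
    (hμ0 : 0 ≤ μ)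
    (H1 : ∑ b, ρ b * ∑ s, |PS s - ∑ x, a b s x| ≤ c1)
    (H2 : ∀ k, ∑ b, ρ b * ∑ s, ∑ x, a b s x * ∑ y, W k x s y * (if mt b y then 0 else 1) ≤ κ k)
    (H3 : ∀ y, ∑ b, ρ b * (if mt b y then 1 else 0) ≤ μ)
    (H4 : ∑ b, ρ b * ∑ s, ∑ x, a b s x ≤ 1) (M : ℕ) (hM : 0 < M) :
    ∃ (φ : Fin M → S → X) (ψ : Y → Fin M),
      ∑ m, ∑ k, ∑ s, PS s * ∑ y, W k (φ m s) s y * (if ψ y ≠ m then 1 else 0) ≤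
        M * (∑ k, κ k + Fintype.card ι * (M * μ) + Fintype.card ι * c1) := by
  have hMn : Nonempty (Fin M) := ⟨⟨0, hM⟩⟩
  let ψ : (Fin M → B) → Y → Fin M := fun C y =>
    if h : ∃ m, mt (C m) y then h.choose else ⟨0, hM⟩
  have hψ : ∀ C y m, (if ψ C y ≠ m then (1:ℝ) else 0) ≤
      (if mt (C m) y then 0 else 1) + ∑ m', if m' = m then 0 else (if mt (C m') y then 1 else 0) := by
    intro C y m
    have hnn : ∀ m' ∈ Finset.univ (α := Fin M), (0:ℝ) ≤ if m' = m then 0 else (if mt (C m') y then 1 else 0) := by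
      intro m' _; split_ifs <;> norm_num
    by_cases h1 : mt (C m) y
    · by_cases h2 : ψ C y = m
      · simp only [h2, ne_eq, not_true_eq_false, if_false, h1, if_true, zero_add]
        exact Finset.sum_nonneg hnn
      · have h : ∃ m, mt (C m) y := ⟨m, h1⟩
        have hs : mt (C (ψ C y)) y := by
          simp only [ψ, h, dif_pos]; exact h.choose_spec
        have := Finset.single_le_sum hnn (Finset.mem_univ (ψ C y))
        simp only [h2, if_false, hs, if_true] at this
        simp only [ne_eq, h2, not_false_eq_true, if_true, h1, zero_add]
        exact this
    · have := Finset.sum_nonneg hnn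
      simp only [h1, if_false]
      split_ifs <;> linarith
  let g : (Fin M → B) → Fin M → S → X → ℝ := fun C m s x =>
    ∑ k, ∑ y, W k x s y * (if ψ C y ≠ m then 1 else 0)
  have hmin : ∀ C m s, ∃ x, ∀ x', g C m s x ≤ g C m s x' := fun C m s => Finite.exists_min (g C m s)
  choose φ hφ using hmin
  have hg0 : ∀ C m s x, 0 ≤ g C m s x := fun C m s x =>
    Finset.sum_nonneg fun k _ => Finset.sum_nonneg fun y _ =>
      mul_nonneg (hW0 _ _ _ _) (by split_ifs <;> norm_num)
  have hg1 : ∀ C m s x, g C m s x ≤ Fintype.card ι := by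
    intro C m s x
    have : ∀ k ∈ Finset.univ (α := ι), ∑ y, W k x s y * (if ψ C y ≠ m then (1:ℝ) else 0) ≤ 1 := by
      intro k _
      refine le_trans (Finset.sum_le_sum fun y _ => ?_) (hW1 k x s).le
      have := hW0 k x s y
      split_ifs <;> simp [this]
    refine (Finset.sum_le_sum this).trans (by simp)
  let T1 : B → ℝ := fun b => ∑ s, ∑ x, a b s x * ∑ k, ∑ y, W k x s y * (if mt b y then 0 else 1)
  let T2 : B → B → ℝ := fun b b' =>
    ∑ s, ∑ x, a b s x * ∑ k, ∑ y, W k x s y * (if mt b' y then 1 else 0)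
  let err : (Fin M → B) → Fin M → ℝ := fun C m => ∑ s, PS s * g C m s (φ C m s)
  have hpt : ∀ C m, err C m ≤ T1 (C m) + (∑ m', if m' = m then 0 else T2 (C m) (C m')) +
      Fintype.card ι * ∑ s, |PS s - ∑ x, a (C m) s x| := by
    intro C m
    have e1 : T1 (C m) + (∑ m', if m' = m then 0 else T2 (C m) (C m')) =
        ∑ s, ∑ x, a (C m) s x * ∑ k, ∑ y, W k x s y * ((if mt (C m) y then 0 else 1) +
          ∑ m', if m' = m then 0 else (if mt (C m') y then 1 else 0)) := by
      have : ∀ m', (if m' = m then 0 else T2 (C m) (C m')) = ∑ s, ∑ x, a (C m) s x *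
        ∑ k, ∑ y, W k x s y * (if m' = m then 0 else (if mt (C m') y then 1 else 0)) := by
        intro m'; split_ifs <;> simp [T2]
      simp_rw [this]
      rw [Finset.sum_comm, ← Finset.sum_add_distrib]
      refine Finset.sum_congr rfl fun s _ => ?_
      rw [Finset.sum_comm, ← Finset.sum_add_distrib]
      refine Finset.sum_congr rfl fun x _ => ?_
      rw [← Finset.mul_sum, ← mul_add]
      congr 1
      rw [Finset.sum_comm (s := (Finset.univ : Finset (Fin M))) (t := (Finset.univ : Finset ι)), ← Finset.sum_add_distrib]
      refine Finset.sum_congr rfl fun k _ => ?_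
      rw [Finset.sum_comm (s := (Finset.univ : Finset (Fin M))) (t := (Finset.univ : Finset Y)), ← Finset.sum_add_distrib]
      refine Finset.sum_congr rfl fun y _ => ?_
      rw [← Finset.mul_sum, ← mul_add]
    rw [e1, Finset.mul_sum, ← Finset.sum_add_distrib]
    refine Finset.sum_le_sum fun s _ => ?_
    have h1 : (∑ x, a (C m) s x) * g C m s (φ C m s) ≤ ∑ x, a (C m) s x * ∑ k, ∑ y, W k x s y * ((if mt (C m) y then 0 else 1) +
          ∑ m', if m' = m then 0 else (if mt (C m') y then 1 else 0)) := by
      rw [Finset.sum_mul]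
      refine Finset.sum_le_sum fun x _ => mul_le_mul_of_nonneg_left ?_ (ha0 _ _ _)
      refine (hφ C m s x).trans ?_
      refine Finset.sum_le_sum fun k _ => Finset.sum_le_sum fun y _ =>
        mul_le_mul_of_nonneg_left (hψ C y m) (hW0 _ _ _ _)
    have h2 : (PS s - ∑ x, a (C m) s x) * g C m s (φ C m s) ≤
        Fintype.card ι * |PS s - ∑ x, a (C m) s x| := by
      rw [mul_comm]
      have := hg0 C m s (φ C m s)
      have := hg1 C m s (φ C m s)
      have := le_abs_self (PS s - ∑ x, a (C m) s x)
      calc _ ≤ g C m s (φ C m s) * |PS s - ∑ x, a (C m) s x| := by gcongr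
        _ ≤ _ := by gcongr
    linarith
  -- expectations
  have E1 : ∑ b, ρ b * T1 b ≤ ∑ k, κ k := by
    have : ∀ b, ρ b * T1 b = ∑ k, ρ b * ∑ s, ∑ x, a b s x * ∑ y, W k x s y * (if mt b y then 0 else 1) := by
      intro b
      simp only [T1]
      rw [← Finset.mul_sum]; congr 1
      rw [Finset.sum_comm (s := (Finset.univ : Finset ι)) (t := (Finset.univ : Finset S))]
      refine Finset.sum_congr rfl fun s _ => ?_
      rw [Finset.sum_comm (s := (Finset.univ : Finset ι)) (t := (Finset.univ : Finset X))]
      refine Finset.sum_congr rfl fun x _ => ?_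
      rw [Finset.mul_sum]
    simp_rw [this]
    rw [Finset.sum_comm]
    exact Finset.sum_le_sum fun k _ => H2 k
  have E2 : ∑ b, ∑ b', ρ b * (ρ b' * T2 b b') ≤ Fintype.card ι * μ := by
    have h : ∀ b, ∑ b', ρ b' * T2 b b' ≤ (∑ s, ∑ x, a b s x) * (Fintype.card ι * μ) := by
      intro b
      simp only [T2, Finset.mul_sum]
      rw [Finset.sum_comm, Finset.sum_mul]
      refine Finset.sum_le_sum fun s _ => ?_
      rw [Finset.sum_comm, Finset.sum_mul]
      refine Finset.sum_le_sum fun x _ => ?_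
      have : ∑ k, ∑ y, W k x s y * μ = Fintype.card ι * μ := by
        simp_rw [← Finset.sum_mul, hW1]; simp
      rw [← this, Finset.sum_comm, Finset.mul_sum]
      refine Finset.sum_le_sum fun k _ => ?_
      rw [Finset.sum_comm, Finset.mul_sum]
      refine Finset.sum_le_sum fun y _ => ?_
      calc _ = a b s x * (W k x s y * ∑ b', ρ b' * (if mt b' y then 1 else 0)) := by
            simp_rw [Finset.mul_sum]; exact Finset.sum_congr rfl fun _ _ => by ring
        _ ≤ _ := mul_le_mul_of_nonneg_left (mul_le_mul_of_nonneg_left (H3 y) (hW0 _ _ _ _)) (ha0 _ _ _)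
    calc _ = ∑ b, ρ b * ∑ b', (ρ b' * T2 b b') := by simp_rw [Finset.mul_sum]
      _ ≤ ∑ b, ρ b * ((∑ s, ∑ x, a b s x) * (Fintype.card ι * μ)) :=
        Finset.sum_le_sum fun b _ => mul_le_mul_of_nonneg_left (h b) (hρ0 b)
      _ = (∑ b, ρ b * ∑ s, ∑ x, a b s x) * (Fintype.card ι * μ) := by
        rw [Finset.sum_mul]; exact Finset.sum_congr rfl fun _ _ => by ring
      _ ≤ 1 * (Fintype.card ι * μ) := mul_le_mul_of_nonneg_right H4 (by positivity)
      _ = _ := one_mul _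
  have E : ∀ m, ∑ C : Fin M → B, (∏ i, ρ (C i)) * err C m ≤
      ∑ k, κ k + Fintype.card ι * (M * μ) + Fintype.card ι * c1 := by
    intro m
    have hle : ∑ C : Fin M → B, (∏ i, ρ (C i)) * err C m ≤
      ∑ C : Fin M → B, (∏ i, ρ (C i)) * (T1 (C m) + (∑ m', if m' = m then 0 else T2 (C m) (C m')) +
      Fintype.card ι * ∑ s, |PS s - ∑ x, a (C m) s x|) :=
      Finset.sum_le_sum fun C _ => mul_le_mul_of_nonneg_left (hpt C m)
        (Finset.prod_nonneg fun i _ => hρ0 _)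
    refine hle.trans ?_
    simp_rw [mul_add, Finset.sum_add_distrib]
    refine add_le_add (add_le_add ?_ ?_) ?_
    · rw [one_marg ρ hρ1 m T1]; exact E1
    · simp_rw [Finset.mul_sum]
      rw [Finset.sum_comm]
      have : ∀ m' ∈ Finset.univ (α := Fin M), ∑ C : Fin M → B, (∏ i, ρ (C i)) * (if m' = m then 0 else T2 (C m) (C m')) ≤
          Fintype.card ι * μ := by
        intro m' _
        by_cases h : m' = m
        · simp [h]; positivity
        · simp only [h, if_false]
          rw [pair_marg ρ hρ1 (Ne.symm h) T2]; exact E2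
      refine (Finset.sum_le_sum this).trans (le_of_eq ?_)
      simp; ring
    · rw [one_marg ρ hρ1 m (fun b => Fintype.card ι * ∑ s, |PS s - ∑ x, a b s x|)]
      have : ∑ b, ρ b * (Fintype.card ι * ∑ s, |PS s - ∑ x, a b s x|) =
        Fintype.card ι * ∑ b, ρ b * (∑ s, |PS s - ∑ x, a b s x|) := by
        rw [Finset.mul_sum]; exact Finset.sum_congr rfl fun _ _ => by ring
      rw [this]; gcongr
  obtain ⟨C, hC⟩ : ∃ C : Fin M → B, ∑ m, err C m ≤
      M * (∑ k, κ k + Fintype.card ι * (M * μ) + Fintype.card ι * c1) := by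
    by_contra hcon
    push Not at hcon
    have hsum : ∑ C : Fin M → B, (∏ i, ρ (C i)) * ∑ m, err C m ≤
        M * (∑ k, κ k + Fintype.card ι * (M * μ) + Fintype.card ι * c1) := by
      simp_rw [Finset.mul_sum]
      rw [Finset.sum_comm]
      refine (Finset.sum_le_sum fun m _ => E m).trans (le_of_eq (by rw [Finset.sum_const]; simp; ring))
    have htot := total_mass (ι := Fin M) ρ hρ1
    have hex : ∃ C : Fin M → B, 0 < ∏ i, ρ (C i) := by
      by_contra h0
      push Not at h0
      have : ∑ C : Fin M → B, (∏ i, ρ (C i)) ≤ 0 := Finset.sum_nonpos fun C _ => h0 C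
      linarith
    obtain ⟨C0, hC0⟩ := hex
    have : ∑ C : Fin M → B, (∏ i, ρ (C i)) * (M * (∑ k, κ k + Fintype.card ι * (M * μ) + Fintype.card ι * c1)) <
       ∑ C : Fin M → B, (∏ i, ρ (C i)) * ∑ m, err C m :=
      Finset.sum_lt_sum (fun C _ => mul_le_mul_of_nonneg_left (hcon C).le (Finset.prod_nonneg fun i _ => hρ0 _))
        ⟨C0, Finset.mem_univ _, mul_lt_mul_of_pos_left (hcon C0) hC0⟩
    rw [← Finset.sum_mul, htot, one_mul] at this
    linarith
  refine ⟨φ C, ψ C, le_trans (le_of_eq ?_) hC⟩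
  refine Finset.sum_congr rfl fun m _ => ?_
  rw [Finset.sum_comm]
  refine Finset.sum_congr rfl fun s _ => ?_
  simp only [g]
  rw [Finset.mul_sum]

lemma l1_dev' {B : Type*} [Fintype B] (L : ℕ) (hL : 0 < L)
    (ρ : B → ℝ) (hρ0 : ∀ b, 0 ≤ ρ b) (hρ : ∑ b, ρ b = 1) (f : B → ℝ) (V c P : ℝ) (hc : 0 < c)
    (hP : 0 ≤ P) (hV : ∑ b, ρ b * f b ^ 2 ≤ V * P * P) :
    ∑ b : Fin L → B, (∏ i, ρ (b i)) * |(∑ l, f (b l)) / L - ∑ b, ρ b * f b| ≤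
      P * (c + V / (L * c)) := by
  rcases hP.eq_or_lt with h | h
  · subst h
    refine le_of_forall_pos_le_add fun ε hε => ?_
    have := l1_dev L hL ρ hρ0 hρ f 0 ε hε (by simpa using hV)
    simpa using this
  · have := l1_dev L hL ρ hρ0 hρ f (V * P * P) (c * P) (by positivity) hV
    refine this.trans (le_of_eq ?_)
    have hLr : (0:ℝ) < L := by exact_mod_cast hL
    field_simp

lemma dep_marg {ι : Type*} {B : ι → Type*} [Fintype ι] [DecidableEq ι] [∀ i, Fintype (B i)]
    (ρ : ∀ i, B i → ℝ) (hρ : ∀ i, ∑ b, ρ i b = 1) (j : ι) (h : B j → ℝ) :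
    ∑ c : ∀ i, B i, (∏ i, ρ i (c i)) * h (c j) = ∑ a, ρ j a * h a := by
  classical
  have h1 : ∀ c : ∀ i, B i, (∏ i, ρ i (c i)) * h (c j) =
      ∏ i, (ρ i (c i) * if e : i = j then h (e ▸ c i) else 1) := by
    intro c
    rw [Finset.prod_mul_distrib]
    congr 1
    rw [Finset.prod_eq_single j]
    · simp
    · intro i _ hi; simp [hi]
    · simp
  simp_rw [h1]
  rw [sum_pi_prod (fun i b => ρ i b * if e : i = j then h (e ▸ b) else 1)]
  rw [Finset.prod_eq_single j]
  · simp
  · intro i _ hi; simp [hi, hρ]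
  · simp

lemma sel_two {U ι : Type*} {V : ι → Type*} [Fintype U] [Fintype ι] [DecidableEq ι]
    [∀ k, Fintype (V k)] (q : U → ℝ) (qv : ∀ k, U → V k → ℝ) (hqv1 : ∀ k u, ∑ a, qv k u a = 1)
    (J : ι → ℕ) (j j' : ∀ k, Fin (J k)) (F G : U → (∀ k, V k) → ℝ) :
    ∑ d : U × (∀ k, Fin (J k) → V k), (q d.1 * ∏ k, ∏ i, qv k d.1 (d.2 k i)) *
        (F d.1 (fun k => d.2 k (j k)) * G d.1 (fun k => d.2 k (j' k))) =
      ∑ u, ∑ v : ∀ k, V k, (q u * ∏ k, qv k u (v k)) * (F u v *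
        ∑ v' : ∀ k, V k, (∏ k, qv k u (v' k)) *
          G u ((Finset.univ.filter (fun k => j k = j' k)).piecewise v v')) := by
  classical
  rw [Fintype.sum_prod_type]
  refine Finset.sum_congr rfl fun u _ => ?_
  simp_rw [mul_assoc (q u)]
  rw [← Finset.mul_sum, ← Finset.mul_sum]
  congr 1
  rw [push_two (fun k (c : Fin (J k) → V k) => ∏ i, qv k u (c i)) (fun k c => c (j k))
    (fun k c => c (j' k)) (fun v w => F u v * G u w)]
  refine Finset.sum_congr rfl fun v _ => ?_
  have := push_one (fun k b => qv k u b) (fun k b => if k ∈ Finset.univ.filter (fun k => j k = j' k) then v k else b) (G u)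
  have hpw : ∀ v' : ∀ k, V k, (Finset.univ.filter (fun k => j k = j' k)).piecewise v v' =
      fun k => if k ∈ Finset.univ.filter (fun k => j k = j' k) then v k else v' k := by
    intro v'; ext k; simp [Finset.piecewise]
  simp_rw [hpw]
  rw [this, Finset.mul_sum, Finset.mul_sum]
  refine Finset.sum_congr rfl fun w _ => ?_
  have key : ∀ k, (∑ c : Fin (J k) → V k, if c (j k) = v k ∧ c (j' k) = w k then ∏ i, qv k u (c i) else 0) =
      qv k u (v k) * ∑ b, if (if k ∈ Finset.univ.filter (fun k => j k = j' k) then v k else b) = w k then qv k u b else 0 := by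
    intro k
    have e : ∀ c : Fin (J k) → V k, (if c (j k) = v k ∧ c (j' k) = w k then ∏ i, qv k u (c i) else 0) =
      (∏ i, qv k u (c i)) * ((if c (j k) = v k then 1 else 0) * (if c (j' k) = w k then 1 else 0)) := by
      intro c; by_cases h1 : c (j k) = v k <;> by_cases h2 : c (j' k) = w k <;> simp [h1, h2]
    simp_rw [e]
    by_cases h : j k = j' k
    · rw [← h, one_marg (qv k u) (hqv1 k u) (j k) (fun a => (if a = v k then 1 else 0) * (if a = w k then 1 else 0))]
      simp only [Finset.mem_filter, Finset.mem_univ, true_and, h, if_true]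
      by_cases h2 : v k = w k
      · simp [h2, hqv1]
      · simp only [h2, if_false]
        simp only [Finset.sum_const_zero, mul_zero]
        refine Finset.sum_eq_zero fun a _ => ?_
        by_cases h3 : a = v k
        · subst h3; simp [h2]
        · simp [h3]
    · rw [pair_prod (qv k u) (hqv1 k u) h (fun a => if a = v k then 1 else 0) (fun a => if a = w k then 1 else 0)]
      simp [h]
  rw [Finset.prod_congr rfl fun k _ => key k, Finset.prod_mul_distrib]
  ring

lemma sel_one {U ι : Type*} {V : ι → Type*} [Fintype U] [Fintype ι] [DecidableEq ι]
    [∀ k, Fintype (V k)] (q : U → ℝ) (qv : ∀ k, U → V k → ℝ) (hqv1 : ∀ k u, ∑ a, qv k u a = 1)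
    (J : ι → ℕ) (j : ∀ k, Fin (J k)) (F : U → (∀ k, V k) → ℝ) :
    ∑ d : U × (∀ k, Fin (J k) → V k), (q d.1 * ∏ k, ∏ i, qv k d.1 (d.2 k i)) *
        (F d.1 (fun k => d.2 k (j k))) =
      ∑ u, ∑ v : ∀ k, V k, (q u * ∏ k, qv k u (v k)) * F u v := by
  have := sel_two q qv hqv1 J j j F (fun _ _ => 1)
  simp only [mul_one] at this
  rw [this]
  refine Finset.sum_congr rfl fun u _ => Finset.sum_congr rfl fun v _ => ?_
  rw [sum_pi_prod (fun k => qv k u)]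
  simp [hqv1]

lemma agree_count {ι : Type*} [Fintype ι] [DecidableEq ι] (J : ι → ℕ) (hJ : ∀ k, 0 < J k)
    (β : Finset ι → ℝ) (hβ : ∀ 𝒦, 0 ≤ β 𝒦) :
    ∑ j : ∀ k, Fin (J k), ∑ j' : ∀ k, Fin (J k), β (Finset.univ.filter (fun k => j k = j' k)) ≤
      (∏ k, (J k : ℝ)) ^ 2 * ∑ 𝒦, β 𝒦 / ∏ k ∈ 𝒦, (J k : ℝ) := by
  have h1 : ∀ j : ∀ k, Fin (J k), ∑ j' : ∀ k, Fin (J k), β (Finset.univ.filter (fun k => j k = j' k)) ≤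
      (∏ k, (J k : ℝ)) * ∑ 𝒦, β 𝒦 / ∏ k ∈ 𝒦, (J k : ℝ) := by
    intro j
    have h2 : ∀ j' : ∀ k, Fin (J k), β (Finset.univ.filter (fun k => j k = j' k)) ≤
        ∑ 𝒦, β 𝒦 * ∏ k, (if k ∈ 𝒦 then (if j k = j' k then 1 else 0) else 1) := by
      intro j'
      have hnn : ∀ 𝒦 ∈ Finset.univ (α := Finset ι),
          0 ≤ β 𝒦 * ∏ k, (if k ∈ 𝒦 then (if j k = j' k then (1:ℝ) else 0) else 1) := fun 𝒦 _ =>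
        mul_nonneg (hβ 𝒦) (Finset.prod_nonneg fun k _ => by split_ifs <;> norm_num)
      refine le_trans (le_of_eq ?_) (Finset.single_le_sum hnn (Finset.mem_univ (Finset.univ.filter (fun k => j k = j' k))))
      rw [Finset.prod_eq_one, mul_one]
      intro k _
      simp only [Finset.mem_filter, Finset.mem_univ, true_and]
      split_ifs <;> rfl
    refine (Finset.sum_le_sum fun j' _ => h2 j').trans (le_of_eq ?_)
    rw [Finset.sum_comm, Finset.mul_sum]
    refine Finset.sum_congr rfl fun 𝒦 _ => ?_
    rw [← Finset.mul_sum, sum_pi_prod (fun k (i : Fin (J k)) => (if k ∈ 𝒦 then (if j k = i then (1:ℝ) else 0) else 1))]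
    have h3 : ∀ k, (∑ i : Fin (J k), (if k ∈ 𝒦 then (if j k = i then (1:ℝ) else 0) else 1)) =
        J k / (if k ∈ 𝒦 then (J k : ℝ) else 1) := by
      intro k
      have : (J k : ℝ) ≠ 0 := by exact_mod_cast (hJ k).ne'
      split_ifs <;> simp [this]
    rw [Finset.prod_congr rfl fun k _ => h3 k, Finset.prod_div_distrib, Finset.prod_ite_mem]
    simp only [Finset.univ_inter]
    ring
  refine (Finset.sum_le_sum fun j _ => h1 j).trans (le_of_eq ?_)
  simp [sq]; ring

set_option maxHeartbeats 1000000 in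
open Classical in
theorem one_shot {X S Y U ι : Type*} {V : ι → Type*} [Fintype X] [Fintype S] [Fintype Y]
    [Fintype U] [Fintype ι] [DecidableEq ι] [∀ k, Fintype (V k)] [Nonempty X]
    (p : S → U → (∀ k, V k) → X → ℝ) (hp0 : ∀ s u v x, 0 ≤ p s u v x)
    (PS : S → ℝ) (hPS : ∀ s, ∑ u, ∑ v, ∑ x, p s u v x = PS s) (hPS1 : ∑ s, PS s = 1)
    (W : ι → X → S → Y → ℝ)
    (hW0 : ∀ k x s y, 0 ≤ W k x s y) (hW1 : ∀ k x s, ∑ y, W k x s y = 1)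
    (q : U → ℝ) (hq0 : ∀ u, 0 ≤ q u) (hq1 : ∑ u, q u = 1)
    (qv : ∀ k, U → V k → ℝ) (hqv0 : ∀ k u a, 0 ≤ qv k u a) (hqv1 : ∀ k u, ∑ a, qv k u a = 1)
    (hac : ∀ s u v x, q u * ∏ k, qv k u (v k) = 0 → p s u v x = 0)
    (A : S → U → (∀ k, V k) → Prop) (β : Finset ι → ℝ) (hβ : ∀ 𝒦, 0 ≤ β 𝒦)
    (hA : ∀ s u v 𝒦, A s u v → ∑ v' : ∀ k, V k, (∏ k, qv k u (v' k)) *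
      ((∑ x, p s u (Finset.piecewise 𝒦 v v') x) / (q u * ∏ k, qv k u (Finset.piecewise 𝒦 v v' k)))
        ≤ β 𝒦 * PS s)
    (test : ∀ k, U → V k → Y → Prop) (τ κ : ι → ℝ)
    (hτ : ∀ k y, ∑ u, q u * ∑ a, qv k u a * (if test k u a y then 1 else 0) ≤ τ k)
    (hτ0 : ∀ k, 0 ≤ τ k)
    (hκ : ∀ k, ∑ s, ∑ u, ∑ v, ∑ x, p s u v x * ∑ y, W k x s y *
      (if test k u (v k) y then 0 else 1) ≤ κ k)
    (α : ℝ) (hα : ∑ s, ∑ u, ∑ v, ∑ x, p s u v x * (if A s u v then 0 else 1) ≤ α)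
    (L : ℕ) (hL : 0 < L) (J : ι → ℕ) (hJ : ∀ k, 0 < J k) (c : ℝ) (hc : 0 < c)
    (M : ℕ) (hM : 0 < M) :
    ∃ (φ : Fin M → S → X) (ψ : Y → Fin M),
      ∑ m, ∑ k, ∑ s, PS s * ∑ y, W k (φ m s) s y * (if ψ y ≠ m then 1 else 0) ≤
        M * (∑ k, κ k + Fintype.card ι * (M * ∑ k, L * (J k * τ k)) +
          Fintype.card ι * (α + (c + (∑ 𝒦, β 𝒦 / ∏ k ∈ 𝒦, (J k : ℝ)) / (L * c)))) := by
  have hLr : (0:ℝ) < L := by exact_mod_cast hL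
  set N : ℝ := ∏ k, (J k : ℝ) with hN
  have hN0 : 0 < N := Finset.prod_pos fun k _ => by exact_mod_cast hJ k
  have hNc : (Fintype.card (∀ k, Fin (J k)) : ℝ) = N := by simp [hN]
  let Q : U → (∀ k, V k) → ℝ := fun u v => q u * ∏ k, qv k u (v k)
  have hQ0 : ∀ u v, 0 ≤ Q u v := fun u v => mul_nonneg (hq0 u) (Finset.prod_nonneg fun k _ => hqv0 _ _ _)
  let ρD : U × (∀ k, Fin (J k) → V k) → ℝ := fun d => q d.1 * ∏ k, ∏ i, qv k d.1 (d.2 k i)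
  have hρD0 : ∀ d, 0 ≤ ρD d := fun d => mul_nonneg (hq0 _) (Finset.prod_nonneg fun k _ =>
    Finset.prod_nonneg fun i _ => hqv0 _ _ _)
  have hρD1 : ∑ d, ρD d = 1 := by
    have := sel_one q qv hqv1 J (fun k => ⟨0, hJ k⟩) (fun _ _ => 1)
    simp only [mul_one] at this
    rw [show ∑ d, ρD d = _ from this]
    simp_rw [← Finset.mul_sum]
    rw [← hq1]
    refine Finset.sum_congr rfl fun u _ => ?_
    rw [sum_pi_prod (fun k => qv k u)]; simp [hqv1]
  let ρ : (Fin L → U × (∀ k, Fin (J k) → V k)) → ℝ := fun b => ∏ l, ρD (b l)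
  have hρ0 : ∀ b, 0 ≤ ρ b := fun b => Finset.prod_nonneg fun l _ => hρD0 _
  have hρ1 : ∑ b, ρ b = 1 := total_mass ρD hρD1
  let sel : U × (∀ k, Fin (J k) → V k) → (∀ k, Fin (J k)) → ∀ k, V k := fun d j k => d.2 k (j k)
  let ω : S → U → (∀ k, V k) → X → ℝ := fun s u v x => if A s u v then p s u v x / Q u v else 0
  have hω0 : ∀ s u v x, 0 ≤ ω s u v x := fun s u v x => by
    simp only [ω]; split_ifs
    · exact div_nonneg (hp0 _ _ _ _) (hQ0 _ _)
    · exact le_rfl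
  have hQω : ∀ s u v x, Q u v * ω s u v x = p s u v x * (if A s u v then 1 else 0) := by
    intro s u v x
    simp only [ω]; split_ifs
    · by_cases h : Q u v = 0
      · rw [h, hac s u v x h]; simp
      · field_simp
    · simp
  have hQωle : ∀ s u v x, Q u v * ω s u v x ≤ p s u v x := by
    intro s u v x
    rw [hQω]; have := hp0 s u v x; split_ifs <;> simp [this]
  have ED : ∀ (j : ∀ k, Fin (J k)) (F : U → (∀ k, V k) → ℝ),
      ∑ d, ρD d * F d.1 (sel d j) = ∑ u, ∑ v, Q u v * F u v := fun j F => sel_one q qv hqv1 J j F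
  have ED' : ∀ (F : U → (∀ k, V k) → ℝ),
      ∑ d, ρD d * ((∑ j, F d.1 (sel d j)) / N) = ∑ u, ∑ v, Q u v * F u v := by
    intro F
    have : ∀ d, ρD d * ((∑ j, F d.1 (sel d j)) / N) = (∑ j, ρD d * F d.1 (sel d j)) / N := by
      intro d; rw [← Finset.mul_sum]; ring
    simp_rw [this]
    rw [← Finset.sum_div, Finset.sum_comm, Finset.sum_congr rfl fun j _ => ED j F]
    rw [Finset.sum_const, Finset.card_univ, nsmul_eq_mul, hNc]
    field_simp
  have EB : ∀ (F : U → (∀ k, V k) → ℝ),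
      ∑ b, ρ b * ((∑ l, (∑ j, F (b l).1 (sel (b l) j)) / N) / L) = ∑ u, ∑ v, Q u v * F u v := by
    intro F
    have : ∀ b : Fin L → U × (∀ k, Fin (J k) → V k), ρ b * ((∑ l, (∑ j, F (b l).1 (sel (b l) j)) / N) / L) =
      (∑ l, ρ b * ((∑ j, F (b l).1 (sel (b l) j)) / N)) / L := by
      intro b; rw [← Finset.mul_sum]; ring
    simp_rw [this]
    rw [← Finset.sum_div, Finset.sum_comm]
    rw [Finset.sum_congr rfl fun l _ => one_marg ρD hρD1 l (fun d => (∑ j, F d.1 (sel d j)) / N)]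
    rw [ED' F]
    rw [Finset.sum_const, Finset.card_univ, nsmul_eq_mul, Fintype.card_fin]
    field_simp
  let a : (Fin L → U × (∀ k, Fin (J k) → V k)) → S → X → ℝ := fun b s x =>
    (∑ l, (∑ j, ω s (b l).1 (sel (b l) j) x) / N) / L
  have ha0 : ∀ b s x, 0 ≤ a b s x := fun b s x => div_nonneg (Finset.sum_nonneg fun l _ =>
    div_nonneg (Finset.sum_nonneg fun j _ => hω0 _ _ _ _) hN0.le) hLr.le
  obtain ⟨mt, hmt⟩ : ∃ mt : (Fin L → U × (∀ k, Fin (J k) → V k)) → Y → Prop, ∀ b y, mt b y ↔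
    ∃ k, ∃ l, ∃ i, test k (b l).1 ((b l).2 k i) y := ⟨_, fun _ _ => Iff.rfl⟩
  have asum : ∀ b s (h : X → ℝ), ∑ x, a b s x * h x =
      (∑ l, (∑ j, (∑ x, ω s (b l).1 (sel (b l) j) x * h x)) / N) / L := by
    intro b s h
    simp only [a]
    have e : ∀ x, (∑ l, (∑ j, ω s (b l).1 (sel (b l) j) x) / N) / L * h x =
        (∑ l, (∑ j, ω s (b l).1 (sel (b l) j) x * h x) / N) / L := by
      intro x
      rw [div_mul_eq_mul_div, Finset.sum_mul]
      congr 1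
      refine Finset.sum_congr rfl fun l _ => ?_
      rw [div_mul_eq_mul_div, Finset.sum_mul]
    simp_rw [e]
    rw [← Finset.sum_div, Finset.sum_comm]
    congr 1
    refine Finset.sum_congr rfl fun l _ => ?_
    rw [← Finset.sum_div, Finset.sum_comm]
  have psum : ∀ (s) (h : U → (∀ k, V k) → X → ℝ), 
      ∑ u, ∑ v, Q u v * ∑ x, ω s u v x * h u v x =
        ∑ u, ∑ v, ∑ x, p s u v x * (if A s u v then 1 else 0) * h u v x := by
    intro s h
    refine Finset.sum_congr rfl fun u _ => Finset.sum_congr rfl fun v _ => ?_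
    rw [Finset.mul_sum]
    refine Finset.sum_congr rfl fun x _ => ?_
    rw [← mul_assoc, hQω]
  let PA : S → ℝ := fun s => ∑ u, ∑ v, ∑ x, p s u v x * (if A s u v then 1 else 0)
  have hPS0 : ∀ s, 0 ≤ PS s := fun s => by
    rw [← hPS]
    exact Finset.sum_nonneg fun u _ => Finset.sum_nonneg fun v _ => Finset.sum_nonneg fun x _ => hp0 _ _ _ _
  have hPAle : ∀ s, PA s ≤ PS s := fun s => by
    rw [← hPS]
    refine Finset.sum_le_sum fun u _ => Finset.sum_le_sum fun v _ => Finset.sum_le_sum fun x _ => ?_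
    have := hp0 s u v x; split_ifs <;> simp [this]
  refine code_exists ρ hρ0 hρ1 PS W hW0 hW1 a ha0 mt _ _ κ ?_ ?_ ?_ ?_ ?_ M hM
  · exact Finset.sum_nonneg fun k _ => mul_nonneg hLr.le (mul_nonneg (Nat.cast_nonneg _) (hτ0 k))
  · -- H1
    let ζ : S → U × (∀ k, Fin (J k) → V k) → ℝ := fun s d => (∑ j, ∑ x, ω s d.1 (sel d j) x) / N
    have hZ : ∀ b s, ∑ x, a b s x = (∑ l, ζ s (b l)) / L := by
      intro b s
      simpa using asum b s (fun _ => 1)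
    have hmean : ∀ s, ∑ d, ρD d * ζ s d = PA s := by
      intro s
      rw [show ∑ d, ρD d * ζ s d = _ from ED' (fun u v => ∑ x, ω s u v x)]
      have := psum s (fun _ _ _ => 1)
      simp only [mul_one] at this
      exact this
    have hsec : ∀ s, ∑ d, ρD d * ζ s d ^ 2 ≤ (∑ 𝒦, β 𝒦 / ∏ k ∈ 𝒦, (J k : ℝ)) * PS s * PS s := by
      intro s
      have h2 : ∀ j j' : ∀ k, Fin (J k), ∑ d, ρD d * ((∑ x, ω s d.1 (sel d j) x) * (∑ x, ω s d.1 (sel d j') x)) ≤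
          β (Finset.univ.filter (fun k => j k = j' k)) * (PS s * PS s) := by
        intro j j'
        rw [show ∑ d, ρD d * ((∑ x, ω s d.1 (sel d j) x) * (∑ x, ω s d.1 (sel d j') x)) = _ from
          sel_two q qv hqv1 J j j' (fun u v => ∑ x, ω s u v x) (fun u v => ∑ x, ω s u v x)]
        set 𝒦 := Finset.univ.filter (fun k => j k = j' k)
        have h3 : ∀ u v, (∑ x, ω s u v x) *
            ∑ v' : ∀ k, V k, (∏ k, qv k u (v' k)) * ∑ x, ω s u (Finset.piecewise 𝒦 v v') x ≤
            (∑ x, ω s u v x) * (β 𝒦 * PS s) := by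
          intro u v
          by_cases hAv : A s u v
          · refine mul_le_mul_of_nonneg_left ?_ (Finset.sum_nonneg fun x _ => hω0 _ _ _ _)
            refine le_trans (Finset.sum_le_sum fun v' _ => ?_) (hA s u v 𝒦 hAv)
            refine mul_le_mul_of_nonneg_left ?_ (Finset.prod_nonneg fun k _ => hqv0 _ _ _)
            rw [Finset.sum_div]
            refine Finset.sum_le_sum fun x _ => ?_
            simp only [ω]
            split_ifs
            · exact le_rfl
            · exact div_nonneg (hp0 _ _ _ _) (hQ0 _ _)
          · simp [ω, hAv]
        calc _ ≤ ∑ u, ∑ v, Q u v * ((∑ x, ω s u v x) * (β 𝒦 * PS s)) :=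
              Finset.sum_le_sum fun u _ => Finset.sum_le_sum fun v _ =>
                mul_le_mul_of_nonneg_left (h3 u v) (hQ0 u v)
          _ = PA s * (β 𝒦 * PS s) := by
              have := psum s (fun _ _ _ => 1)
              simp only [mul_one] at this
              rw [show PA s = _ from this.symm, Finset.sum_mul]
              refine Finset.sum_congr rfl fun u _ => ?_
              rw [Finset.sum_mul]
              refine Finset.sum_congr rfl fun v _ => by ring
          _ ≤ PS s * (β 𝒦 * PS s) := mul_le_mul_of_nonneg_right (hPAle s) (mul_nonneg (hβ _) (hPS0 s))
          _ = _ := by ring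
      have e : ∀ d, ρD d * ζ s d ^ 2 = (∑ j, ∑ j', ρD d * ((∑ x, ω s d.1 (sel d j) x) * (∑ x, ω s d.1 (sel d j') x))) / N ^ 2 := by
        intro d
        simp only [ζ]
        rw [div_pow, sq (∑ j, ∑ x, ω s d.1 (sel d j) x), Finset.sum_mul_sum]
        simp_rw [← Finset.mul_sum]
        ring
      simp_rw [e]
      rw [← Finset.sum_div, Finset.sum_comm, div_le_iff₀ (by positivity)]
      calc _ = ∑ j, ∑ j', ∑ d, ρD d * ((∑ x, ω s d.1 (sel d j) x) * (∑ x, ω s d.1 (sel d j') x)) :=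
            Finset.sum_congr rfl fun j _ => Finset.sum_comm
        _ ≤ ∑ j : ∀ k, Fin (J k), ∑ j' : ∀ k, Fin (J k), β (Finset.univ.filter (fun k => j k = j' k)) * (PS s * PS s) :=
            Finset.sum_le_sum fun j _ => Finset.sum_le_sum fun j' _ => h2 j j'
        _ = (∑ j : ∀ k, Fin (J k), ∑ j' : ∀ k, Fin (J k), β (Finset.univ.filter (fun k => j k = j' k))) * (PS s * PS s) := by
            simp_rw [Finset.sum_mul]
        _ ≤ _ := mul_le_mul_of_nonneg_right (agree_count J hJ β hβ) (mul_nonneg (hPS0 s) (hPS0 s))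
        _ = _ := by ring
    set Bs := ∑ 𝒦, β 𝒦 / ∏ k ∈ 𝒦, (J k : ℝ)
    have h4 : ∀ s, ∑ b, ρ b * |PS s - ∑ x, a b s x| ≤ (PS s - PA s) + PS s * (c + Bs / (L * c)) := by
      intro s
      have := l1_dev' L hL ρD hρD0 hρD1 (ζ s) Bs c (PS s) hc (hPS0 s) (hsec s)
      rw [hmean s] at this
      refine le_trans ?_ (add_le_add (le_refl (PS s - PA s)) this)
      have e : PS s - PA s = ∑ b, ρ b * (PS s - PA s) := by rw [← Finset.sum_mul, hρ1, one_mul]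
      rw [e, ← Finset.sum_add_distrib]
      refine Finset.sum_le_sum fun b _ => ?_
      rw [← mul_add, hZ]
      refine mul_le_mul_of_nonneg_left ?_ (hρ0 b)
      have := hPAle s
      calc _ = |(PS s - PA s) - ((∑ l, ζ s (b l)) / L - PA s)| := by congr 1; ring
        _ ≤ |PS s - PA s| + |(∑ l, ζ s (b l)) / L - PA s| := abs_sub _ _
        _ = _ := by rw [abs_of_nonneg (by linarith : 0 ≤ PS s - PA s)]
    simp_rw [Finset.mul_sum]
    rw [Finset.sum_comm]
    refine (Finset.sum_le_sum fun s _ => h4 s).trans ?_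
    rw [Finset.sum_add_distrib, ← Finset.sum_mul, hPS1, one_mul]
    refine add_le_add (le_trans (le_of_eq ?_) hα) le_rfl
    refine Finset.sum_congr rfl fun s _ => ?_
    rw [← hPS]
    simp only [PA]
    simp_rw [← Finset.sum_sub_distrib]
    refine Finset.sum_congr rfl fun u _ => Finset.sum_congr rfl fun v _ => Finset.sum_congr rfl fun x _ => ?_
    split_ifs <;> ring
  · -- H2
    intro k
    refine le_trans ?_ (hκ k)
    obtain ⟨F, hF⟩ : ∃ F : U → (∀ k, V k) → ℝ, F = fun u v =>
      ∑ s, ∑ x, ω s u v x * ∑ y, W k x s y * (if test k u (v k) y then 0 else 1) := ⟨_, rfl⟩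
    have h1 : ∀ b, ∑ s, ∑ x, a b s x * ∑ y, W k x s y * (if mt b y then 0 else 1) ≤
        (∑ l, (∑ j, F (b l).1 (sel (b l) j)) / N) / L := by
      intro b
      simp only [hF]
      have e : ∀ s, ∑ x, a b s x * ∑ y, W k x s y * (if mt b y then 0 else 1) ≤
        (∑ l, (∑ j, (∑ x, ω s (b l).1 (sel (b l) j) x * 
          ∑ y, W k x s y * (if test k (b l).1 (sel (b l) j k) y then 0 else 1))) / N) / L := by
        intro s
        rw [asum]
        gcongr with l _ j _ x _ y _
        · exact hω0 _ _ _ _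
        · exact hW0 _ _ _ _
        · by_cases ht : test k (b l).1 (sel (b l) j k) y
          · have : mt b y := (hmt b y).2 ⟨k, l, j k, ht⟩
            simp [this, ht]
          · simp only [ht, if_false]; split_ifs <;> norm_num
      refine (Finset.sum_le_sum fun s _ => e s).trans (le_of_eq ?_)
      rw [← Finset.sum_div, Finset.sum_comm]
      congr 1
      refine Finset.sum_congr rfl fun l _ => ?_
      rw [← Finset.sum_div, Finset.sum_comm]
    refine (Finset.sum_le_sum fun b _ => mul_le_mul_of_nonneg_left (h1 b) (hρ0 b)).trans ?_
    refine (EB F).le.trans ?_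
    simp only [hF]
    have : ∑ s, ∑ u, ∑ v, ∑ x, p s u v x * ∑ y, W k x s y * (if test k u (v k) y then 0 else 1) =
      ∑ u, ∑ v, ∑ s, ∑ x, p s u v x * ∑ y, W k x s y * (if test k u (v k) y then 0 else 1) := by
      rw [Finset.sum_comm]
      exact Finset.sum_congr rfl fun u _ => Finset.sum_comm
    rw [this]
    refine Finset.sum_le_sum fun u _ => Finset.sum_le_sum fun v _ => ?_
    rw [Finset.mul_sum]
    refine Finset.sum_le_sum fun s _ => ?_
    rw [Finset.mul_sum]
    refine Finset.sum_le_sum fun x _ => ?_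
    rw [← mul_assoc]
    refine mul_le_mul_of_nonneg_right (hQωle _ _ _ _) ?_
    exact Finset.sum_nonneg fun y _ => mul_nonneg (hW0 _ _ _ _) (by split_ifs <;> norm_num)
  · -- H3
    intro y
    have h1 : ∀ b : Fin L → U × (∀ k, Fin (J k) → V k), (if mt b y then (1:ℝ) else 0) ≤
        ∑ k, ∑ l, ∑ i, if test k (b l).1 ((b l).2 k i) y then (1:ℝ) else 0 := by
      intro b
      by_cases h : mt b y
      · obtain ⟨k, l, i, hk⟩ := (hmt b y).1 h
        simp only [h, if_true]
        have n1 : ∀ k l i, (0:ℝ) ≤ if test k (b l).1 ((b l).2 k i) y then (1:ℝ) else 0 := by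
          intro k l i; split_ifs <;> norm_num
        calc (1:ℝ) = if test k (b l).1 ((b l).2 k i) y then (1:ℝ) else 0 := by simp [hk]
          _ ≤ ∑ i, if test k (b l).1 ((b l).2 k i) y then (1:ℝ) else 0 :=
            Finset.single_le_sum (f := fun i => if test k (b l).1 ((b l).2 k i) y then (1:ℝ) else 0) (fun i _ => n1 k l i) (Finset.mem_univ i)
          _ ≤ ∑ l, ∑ i, if test k (b l).1 ((b l).2 k i) y then (1:ℝ) else 0 :=
            Finset.single_le_sum (f := fun l => ∑ i, if test k (b l).1 ((b l).2 k i) y then (1:ℝ) else 0) (fun l _ => Finset.sum_nonneg fun i _ => n1 k l i) (Finset.mem_univ l)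
          _ ≤ _ := Finset.single_le_sum (f := fun k => ∑ l, ∑ i, if test k (b l).1 ((b l).2 k i) y then (1:ℝ) else 0) (fun k _ => Finset.sum_nonneg fun l _ => Finset.sum_nonneg fun i _ => n1 k l i) (Finset.mem_univ k)
      · simp only [h, if_false]
        exact Finset.sum_nonneg fun k _ => Finset.sum_nonneg fun l _ => Finset.sum_nonneg fun i _ => by split_ifs <;> norm_num
    refine (Finset.sum_le_sum fun b _ => mul_le_mul_of_nonneg_left (h1 b) (hρ0 b)).trans ?_
    simp_rw [Finset.mul_sum]
    rw [Finset.sum_comm]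
    refine Finset.sum_le_sum fun k _ => ?_
    rw [Finset.sum_comm]
    have h2 : ∀ l : Fin L, ∑ b, ∑ i, ρ b * (if test k (b l).1 ((b l).2 k i) y then (1:ℝ) else 0) ≤ J k * τ k := by
      intro l
      rw [Finset.sum_comm]
      have h3 : ∀ i : Fin (J k), ∑ b, ρ b * (if test k (b l).1 ((b l).2 k i) y then (1:ℝ) else 0) ≤ τ k := by
        intro i
        rw [one_marg ρD hρD1 l (fun d => if test k d.1 (d.2 k i) y then (1:ℝ) else 0)]
        let j : ∀ k, Fin (J k) := Function.update (fun k => ⟨0, hJ k⟩) k i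
        have hj : j k = i := by simp [j]
        have := ED j (fun u v => if test k u (v k) y then (1:ℝ) else 0)
        simp only [sel, hj] at this
        rw [this]
        refine le_trans (le_of_eq ?_) (hτ k y)
        refine Finset.sum_congr rfl fun u _ => ?_
        simp only [Q]
        simp_rw [mul_assoc (q u)]
        rw [← Finset.mul_sum, dep_marg (fun k => qv k u) (fun k => hqv1 k u) k (fun a => if test k u a y then (1:ℝ) else 0)]
      refine (Finset.sum_le_sum fun i _ => h3 i).trans (le_of_eq (by simp))
    refine (Finset.sum_le_sum fun l _ => h2 l).trans (le_of_eq (by simp))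
  · -- H4
    have e : ∀ b, ∑ s, ∑ x, a b s x = (∑ l, (∑ j, (∑ s, ∑ x, ω s (b l).1 (sel (b l) j) x)) / N) / L := by
      intro b
      have : ∀ s, ∑ x, a b s x = (∑ l, (∑ j, (∑ x, ω s (b l).1 (sel (b l) j) x)) / N) / L := by
        intro s; simpa using asum b s (fun _ => 1)
      simp_rw [this]
      rw [← Finset.sum_div, Finset.sum_comm]
      congr 1
      refine Finset.sum_congr rfl fun l _ => ?_
      rw [← Finset.sum_div, Finset.sum_comm]
    simp_rw [e]
    rw [EB (fun u v => ∑ s, ∑ x, ω s u v x), ← hPS1]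
    have e2 : ∑ s, PS s = ∑ u, ∑ v, ∑ s, ∑ x, p s u v x := by
      simp_rw [← hPS]
      rw [Finset.sum_comm]
      exact Finset.sum_congr rfl fun u _ => Finset.sum_comm
    rw [e2]
    refine Finset.sum_le_sum fun u _ => Finset.sum_le_sum fun v _ => ?_
    rw [Finset.mul_sum]
    refine Finset.sum_le_sum fun s _ => ?_
    rw [Finset.mul_sum]
    exact Finset.sum_le_sum fun x _ => hQωle s u v x

open Classical in
lemma wlln {T : Type*} [Fintype T] (p : T → ℝ) (hp0 : ∀ t, 0 ≤ p t) (hp1 : ∑ t, p t = 1)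
    (f : T → ℝ) (μ : ℝ) (hμ : ∑ t, p t * f t = μ) (δ : ℝ) (hδ : 0 < δ) (n : ℕ) (hn : 0 < n) :
    ∑ t : Fin n → T, (∏ i, p (t i)) * (if n * (μ + δ) < ∑ i, f (t i) then 1 else 0) ≤
      ((∑ t, p t * (f t - μ) ^ 2) / δ ^ 2) / n := by
  have hnr : (0:ℝ) < n := by exact_mod_cast hn
  have h0 : ∑ b, p b * (f b - μ) = 0 := by
    simp_rw [mul_sub, Finset.sum_sub_distrib, ← Finset.sum_mul, hp1]; simp [hμ]
  have hm := second_moment (ι := Fin n) p hp1 (fun b => f b - μ) h0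
  have key : ∀ t : Fin n → T, (∏ i, p (t i)) * (if n * (μ + δ) < ∑ i, f (t i) then (1:ℝ) else 0) ≤
      (∏ i, p (t i)) * (∑ i, (f (t i) - μ)) ^ 2 * (1 / (n * δ) ^ 2) := by
    intro t
    have hp : 0 ≤ ∏ i, p (t i) := Finset.prod_nonneg fun i _ => hp0 _
    rw [mul_assoc]
    refine mul_le_mul_of_nonneg_left ?_ hp
    split_ifs with h
    · have e : (∑ i, (f (t i) - μ)) = (∑ i, f (t i)) - n * μ := by simp [Finset.sum_sub_distrib]
      rw [e, mul_one_div, one_le_div (by positivity)]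
      have : n * δ < (∑ i, f (t i)) - n * μ := by linarith
      have h3 : 0 < n * δ := by positivity
      exact pow_le_pow_left₀ h3.le this.le 2
    · positivity
  refine (Finset.sum_le_sum fun t _ => key t).trans ?_
  rw [← Finset.sum_mul, hm]
  simp only [Fintype.card_fin]
  apply le_of_eq
  field_simp

open Classical in
lemma tail_up {T : Type*} [Fintype T] (p : T → ℝ) (hp0 : ∀ t, 0 ≤ p t) (hp1 : ∑ t, p t = 1)
    (r : T → ℝ) (hr : ∀ t, p t ≠ 0 → 0 < r t) (μ : ℝ) (hμ : ∑ t, p t * Real.log (r t) = μ)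
    (δ : ℝ) (hδ : 0 < δ) : ∃ V : ℝ, 0 ≤ V ∧ ∀ n : ℕ, 0 < n → 
    ∑ t : Fin n → T, (∏ i, p (t i)) * (if ∏ i, r (t i) ≤ Real.exp (n * (μ + δ)) then 0 else 1) ≤
      V / n := by
  refine ⟨(∑ t, p t * (Real.log (r t) - μ) ^ 2) / δ ^ 2,
    div_nonneg (Finset.sum_nonneg fun t _ => mul_nonneg (hp0 t) (sq_nonneg _)) (by positivity),
    fun n hn => le_trans (Finset.sum_le_sum fun t _ => ?_)
    (wlln p hp0 hp1 (fun t => Real.log (r t)) μ hμ δ hδ n hn)⟩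
  by_cases h0 : ∏ i, p (t i) = 0
  · simp [h0]
  · have hpos : ∀ i, 0 < r (t i) := fun i => hr _ (fun h => h0 (Finset.prod_eq_zero (Finset.mem_univ i) h))
    refine mul_le_mul_of_nonneg_left ?_ (Finset.prod_nonneg fun i _ => hp0 _)
    rw [← Real.log_prod (fun i _ => (hpos i).ne')]
    by_cases h : ∏ i, r (t i) ≤ Real.exp (n * (μ + δ))
    · simp only [h, if_true]; split_ifs <;> norm_num
    · have : n * (μ + δ) < Real.log (∏ i, r (t i)) := by
        rw [Real.lt_log_iff_exp_lt (Finset.prod_pos fun i _ => hpos i)]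
        exact not_le.mp h
      simp [h, this]

open Classical in
lemma tail_dn {T : Type*} [Fintype T] (p : T → ℝ) (hp0 : ∀ t, 0 ≤ p t) (hp1 : ∑ t, p t = 1)
    (r : T → ℝ) (hr : ∀ t, p t ≠ 0 → 0 < r t) (μ : ℝ) (hμ : ∑ t, p t * Real.log (r t) = μ)
    (δ : ℝ) (hδ : 0 < δ) : ∃ V : ℝ, 0 ≤ V ∧ ∀ n : ℕ, 0 < n → 
    ∑ t : Fin n → T, (∏ i, p (t i)) * (if Real.exp (n * (μ - δ)) < ∏ i, r (t i) then 0 else 1) ≤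
      V / n := by
  obtain ⟨V, hV0, hV⟩ := tail_up p hp0 hp1 (fun t => (r t)⁻¹) (fun t ht => inv_pos.2 (hr t ht)) (-μ)
    (by simp [hμ]) (δ / 2) (by positivity)
  refine ⟨V, hV0, fun n hn => le_trans (Finset.sum_le_sum fun t _ => ?_) (hV n hn)⟩
  by_cases h0 : ∏ i, p (t i) = 0
  · simp [h0]
  · have hpos : ∀ i, 0 < r (t i) := fun i => hr _ (fun h => h0 (Finset.prod_eq_zero (Finset.mem_univ i) h))
    refine mul_le_mul_of_nonneg_left ?_ (Finset.prod_nonneg fun i _ => hp0 _)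
    by_cases h : Real.exp (n * (μ - δ)) < ∏ i, r (t i)
    · simp only [h, if_true]; split_ifs <;> norm_num
    · have h2 : ¬ (∏ i, (r (t i))⁻¹ ≤ Real.exp (n * (-μ + δ / 2))) := by
        rw [Finset.prod_inv_distrib, not_le]
        have hP : 0 < ∏ i, r (t i) := Finset.prod_pos fun i _ => hpos i
        rw [lt_inv_comm₀ (Real.exp_pos _) hP, ← Real.exp_neg]
        refine lt_of_le_of_lt (not_lt.mp h) (Real.exp_lt_exp.2 ?_)
        have hnr : (0:ℝ) < n := by exact_mod_cast hn
        nlinarith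
      rw [if_neg h, if_neg h2]

lemma sum_swap {ι : Type*} {V : ι → Type*} [Fintype ι] [DecidableEq ι] [∀ k, Fintype (V k)] {n : ℕ}
    (f : Fin n → (∀ k, V k) → ℝ) :
    ∑ v : ∀ k, Fin n → V k, ∏ i, f i (fun k => v k i) = ∏ i, ∑ v, f i v := by
  rw [← sum_pi_prod]
  exact Fintype.sum_equiv (Equiv.piComm (fun k (_ : Fin n) => V k)) _ _ (fun v => rfl)

lemma reindex4 {S U X ι : Type*} {V : ι → Type*} [Fintype S] [Fintype U] [Fintype X] [Fintype ι]
    [DecidableEq ι] [∀ k, Fintype (V k)] {n : ℕ}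
    (Φ : (Fin n → S) → (Fin n → U) → (∀ k, Fin n → V k) → (Fin n → X) → ℝ) :
    ∑ s, ∑ u, ∑ v, ∑ x, Φ s u v x = ∑ t : Fin n → S × U × (∀ k, V k) × X,
      Φ (fun i => (t i).1) (fun i => (t i).2.1) (fun k i => (t i).2.2.1 k) (fun i => (t i).2.2.2) := by
  let e : ((Fin n → S) × (Fin n → U) × (∀ k, Fin n → V k) × (Fin n → X)) ≃ (Fin n → S × U × (∀ k, V k) × X) :=
    { toFun := fun w i => (w.1 i, w.2.1 i, fun k => w.2.2.1 k i, w.2.2.2 i)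
      invFun := fun t => (fun i => (t i).1, fun i => (t i).2.1, fun k i => (t i).2.2.1 k, fun i => (t i).2.2.2)
      left_inv := fun w => rfl
      right_inv := fun t => rfl }
  rw [← Fintype.sum_equiv e (fun w => Φ w.1 w.2.1 w.2.2.1 w.2.2.2) _ (fun w => rfl)]
  simp_rw [Fintype.sum_prod_type]

lemma reindex5 {S U X Y ι : Type*} {V : ι → Type*} [Fintype S] [Fintype U] [Fintype X] [Fintype Y] [Fintype ι]
    [DecidableEq ι] [∀ k, Fintype (V k)] {n : ℕ}
    (Φ : (Fin n → S) → (Fin n → U) → (∀ k, Fin n → V k) → (Fin n → X) → (Fin n → Y) → ℝ) :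
    ∑ s, ∑ u, ∑ v, ∑ x, ∑ y, Φ s u v x y = ∑ t : Fin n → S × U × (∀ k, V k) × X × Y,
      Φ (fun i => (t i).1) (fun i => (t i).2.1) (fun k i => (t i).2.2.1 k) (fun i => (t i).2.2.2.1)
        (fun i => (t i).2.2.2.2) := by
  let e : ((Fin n → S) × (Fin n → U) × (∀ k, Fin n → V k) × (Fin n → X) × (Fin n → Y)) ≃
      (Fin n → S × U × (∀ k, V k) × X × Y) :=
    { toFun := fun w i => (w.1 i, w.2.1 i, fun k => w.2.2.1 k i, w.2.2.2.1 i, w.2.2.2.2 i)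
      invFun := fun t => (fun i => (t i).1, fun i => (t i).2.1, fun k i => (t i).2.2.1 k,
        fun i => (t i).2.2.2.1, fun i => (t i).2.2.2.2)
      left_inv := fun w => rfl
      right_inv := fun t => rfl }
  rw [← Fintype.sum_equiv e (fun w => Φ w.1 w.2.1 w.2.2.1 w.2.2.2.1 w.2.2.2.2) _ (fun w => rfl)]
  simp_rw [Fintype.sum_prod_type]

set_option maxHeartbeats 1000000 in
open Classical in
theorem n_shot {X S Y U ι : Type*} {V : ι → Type*} [Fintype X] [Fintype S] [Fintype Y]
    [Fintype U] [Fintype ι] [DecidableEq ι] [∀ k, Fintype (V k)] [Nonempty X]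
    (p : S → U → (∀ k, V k) → X → ℝ) (hp0 : ∀ s u v x, 0 ≤ p s u v x)
    (PS : S → ℝ) (hPS : ∀ s, ∑ u, ∑ v, ∑ x, p s u v x = PS s) (hPS1 : ∑ s, PS s = 1)
    (W : ι → X → S → Y → ℝ)
    (hW0 : ∀ k x s y, 0 ≤ W k x s y) (hW1 : ∀ k x s, ∑ y, W k x s y = 1)
    (q : U → ℝ) (hq0 : ∀ u, 0 ≤ q u) (hq1 : ∑ u, q u = 1)
    (qv : ∀ k, U → V k → ℝ) (hqv0 : ∀ k u a, 0 ≤ qv k u a) (hqv1 : ∀ k u, ∑ a, qv k u a = 1)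
    (hac : ∀ s u v x, q u * ∏ k, qv k u (v k) = 0 → p s u v x = 0)
    (r : Finset ι → S → U → (∀ k, V k) → ℝ)
    (hr : ∀ s u v 𝒦, ∑ v' : ∀ k, V k, (∏ k, qv k u (v' k)) *
      ((∑ x, p s u (Finset.piecewise 𝒦 v v') x) / (q u * ∏ k, qv k u (Finset.piecewise 𝒦 v v' k)))
        ≤ r 𝒦 s u v * PS s)
    (hrpos : ∀ 𝒦 s u v x, p s u v x ≠ 0 → 0 < r 𝒦 s u v)
    (η : Finset ι → ℝ) (hη : ∀ 𝒦, ∑ s, ∑ u, ∑ v, ∑ x, p s u v x * Real.log (r 𝒦 s u v) = η 𝒦)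
    (r' : ∀ k, U → V k → Y → ℝ) (hr'0 : ∀ k u a y, 0 ≤ r' k u a y)
    (hr'1 : ∀ k y, ∑ u, q u * ∑ a, qv k u a * r' k u a y ≤ 1)
    (hr'pos : ∀ k s u v x y, p s u v x * W k x s y ≠ 0 → 0 < r' k u (v k) y)
    (I : ι → ℝ)
    (hI : ∀ k, ∑ s, ∑ u, ∑ v, ∑ x, ∑ y, p s u v x * W k x s y * Real.log (r' k u (v k) y) = I k)
    (δ : ℝ) (hδ : 0 < δ) :
    ∃ C : ℝ, ∀ n : ℕ, 0 < n → ∀ L : ℕ, 0 < L → ∀ J : ι → ℕ, (∀ k, 0 < J k) → ∀ c : ℝ, 0 < c →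
      ∀ M : ℕ, 0 < M → 
    ∃ (φ : Fin M → (Fin n → S) → (Fin n → X)) (ψ : (Fin n → Y) → Fin M),
      ∑ m, ∑ k, ∑ s, (∏ i, PS (s i)) * ∑ y : Fin n → Y, (∏ i, W k (φ m s i) (s i) (y i)) *
          (if ψ y ≠ m then 1 else 0) ≤
        M * (C / n + Fintype.card ι * (M * ∑ k, L * (J k * Real.exp (-(n * (I k - δ))))) +
          Fintype.card ι * (C / n + (c +
            (∑ 𝒦, Real.exp (n * (η 𝒦 + δ)) / ∏ k ∈ 𝒦, (J k : ℝ)) / (L * c)))) := by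
  have hup : ∀ 𝒦, _ := fun 𝒦 => tail_up (T := S × U × (∀ k, V k) × X) (fun t => p t.1 t.2.1 t.2.2.1 t.2.2.2)
    (fun t => hp0 _ _ _ _) (by simp_rw [Fintype.sum_prod_type]; simp_rw [hPS]; exact hPS1)
    (fun t => r 𝒦 t.1 t.2.1 t.2.2.1) (fun t ht => hrpos _ _ _ _ _ ht) (η 𝒦)
    (by simp_rw [Fintype.sum_prod_type]; exact hη 𝒦) δ hδ
  have hdn : ∀ k, _ := fun k => tail_dn (T := S × U × (∀ k, V k) × X × Y)
    (fun t => p t.1 t.2.1 t.2.2.1 t.2.2.2.1 * W k t.2.2.2.1 t.1 t.2.2.2.2)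
    (fun t => mul_nonneg (hp0 _ _ _ _) (hW0 _ _ _ _))
    (by simp_rw [Fintype.sum_prod_type, ← Finset.mul_sum, hW1, mul_one, hPS]; exact hPS1)
    (fun t => r' k t.2.1 (t.2.2.1 k) t.2.2.2.2) (fun t ht => hr'pos _ _ _ _ _ _ ht) (I k)
    (by simp_rw [Fintype.sum_prod_type]; exact hI k) δ hδ
  choose C1 hC10 hC1 using hup
  choose C2 hC20 hC2 using hdn
  have hC1s : 0 ≤ ∑ 𝒦, C1 𝒦 := Finset.sum_nonneg fun 𝒦 _ => hC10 𝒦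
  have hC2s : 0 ≤ ∑ k, C2 k := Finset.sum_nonneg fun k _ => hC20 k
  refine ⟨∑ 𝒦, C1 𝒦 + ∑ k, C2 k, fun n hn L hL J hJ c hc M hM => ?_⟩
  have hnr : (0:ℝ) < n := by exact_mod_cast hn
  obtain ⟨A, hAdef⟩ : ∃ A : (Fin n → S) → (Fin n → U) → (∀ k, Fin n → V k) → Prop, ∀ s u v,
    A s u v ↔ ∀ 𝒦, ∏ i, r 𝒦 (s i) (u i) (fun k => v k i) ≤ Real.exp (n * (η 𝒦 + δ)) :=
    ⟨_, fun _ _ _ => Iff.rfl⟩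
  obtain ⟨test, htest⟩ : ∃ test : ∀ k, (Fin n → U) → (Fin n → V k) → (Fin n → Y) → Prop, ∀ k u a y,
    test k u a y ↔ Real.exp (n * (I k - δ)) < ∏ i, r' k (u i) (a i) (y i) :=
    ⟨_, fun _ _ _ _ => Iff.rfl⟩
  have H := one_shot (X := Fin n → X) (S := Fin n → S) (Y := Fin n → Y) (U := Fin n → U)
    (V := fun k => Fin n → V k) 
    (fun s u v x => ∏ i, p (s i) (u i) (fun k => v k i) (x i))
    (fun s u v x => Finset.prod_nonneg fun i _ => hp0 _ _ _ _)
    (fun s => ∏ i, PS (s i))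
    (by
      intro s
      simp_rw [← hPS]
      rw [← sum_pi_prod (fun i u => ∑ v, ∑ x, p (s i) u v x)]
      refine Finset.sum_congr rfl fun u _ => ?_
      rw [← sum_swap (fun i v => ∑ x, p (s i) (u i) v x)]
      refine Finset.sum_congr rfl fun v _ => ?_
      rw [← sum_pi_prod (fun i x => p (s i) (u i) (fun k => v k i) x)])
    (total_mass PS hPS1)
    (fun k x s y => ∏ i, W k (x i) (s i) (y i))
    (fun k x s y => Finset.prod_nonneg fun i _ => hW0 _ _ _ _)
    (fun k x s => by
      rw [sum_pi_prod (fun i y => W k (x i) (s i) y)]; simp [hW1])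
    (fun u => ∏ i, q (u i)) (fun u => Finset.prod_nonneg fun i _ => hq0 _) (total_mass q hq1)
    (fun k u a => ∏ i, qv k (u i) (a i)) (fun k u a => Finset.prod_nonneg fun i _ => hqv0 _ _ _)
    (fun k u => by rw [sum_pi_prod (fun i a => qv k (u i) a)]; simp [hqv1])
    (by
      intro s u v x h
      rw [Finset.prod_comm, ← Finset.prod_mul_distrib, Finset.prod_eq_zero_iff] at h
      obtain ⟨i, _, hi⟩ := h
      exact Finset.prod_eq_zero (Finset.mem_univ i) (hac _ _ (fun k => v k i) _ hi))
    A (fun 𝒦 => Real.exp (n * (η 𝒦 + δ))) (fun 𝒦 => (Real.exp_pos _).le)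
    (by
      intro s u v 𝒦 hA
      have hA' := (hAdef s u v).1 hA 𝒦
      have hPS0 : ∀ s, 0 ≤ PS s := fun s => by
        rw [← hPS]
        exact Finset.sum_nonneg fun u _ => Finset.sum_nonneg fun v _ => Finset.sum_nonneg fun x _ => hp0 _ _ _ _
      refine le_trans ?_ (mul_le_mul_of_nonneg_right hA' (Finset.prod_nonneg fun i _ => hPS0 _))
      rw [← Finset.prod_mul_distrib]
      refine le_trans (le_of_eq ?_) (Finset.prod_le_prod ?_ (fun i _ => hr (s i) (u i) (fun k => v k i) 𝒦))
      · rw [← sum_swap (fun i v' => (∏ k, qv k (u i) (v' k)) *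
          ((∑ x, p (s i) (u i) (Finset.piecewise 𝒦 (fun k => v k i) v') x) /
            (q (u i) * ∏ k, qv k (u i) (Finset.piecewise 𝒦 (fun k => v k i) v' k))))]
        refine Finset.sum_congr rfl fun v' _ => ?_
        rw [Finset.prod_mul_distrib, Finset.prod_div_distrib, Finset.prod_mul_distrib]
        have hpw : ∀ i, (fun k => Finset.piecewise 𝒦 v v' k i) =
            Finset.piecewise 𝒦 (fun k => v k i) (fun k => v' k i) := by
          intro i; ext k; simp only [Finset.piecewise]; split_ifs <;> rfl
        congr 1
        · exact Finset.prod_comm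
        · congr 1
          · rw [← sum_pi_prod]
            refine Finset.sum_congr rfl fun x _ => Finset.prod_congr rfl fun i _ => ?_
            rw [hpw]
          · congr 1
            rw [Finset.prod_comm]
            refine Finset.prod_congr rfl fun i _ => Finset.prod_congr rfl fun k _ => ?_
            rw [← hpw]
      · intro i _
        refine Finset.sum_nonneg fun v' _ => mul_nonneg (Finset.prod_nonneg fun k _ => hqv0 _ _ _) ?_
        exact div_nonneg (Finset.sum_nonneg fun x _ => hp0 _ _ _ _)
          (mul_nonneg (hq0 _) (Finset.prod_nonneg fun k _ => hqv0 _ _ _)))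
    test (fun k => Real.exp (-(n * (I k - δ)))) (fun k => C2 k / n)
    (by
      intro k y
      have h1 : ∀ u a, (if test k u a y then (1:ℝ) else 0) ≤
          Real.exp (-(n * (I k - δ))) * ∏ i, r' k (u i) (a i) (y i) := by
        intro u a
        split_ifs with h
        · have := ((htest _ _ _ _).1 h).le
          rw [Real.exp_neg, inv_mul_eq_div, one_le_div (Real.exp_pos _)]
          exact this
        · exact mul_nonneg (Real.exp_pos _).le (Finset.prod_nonneg fun i _ => hr'0 _ _ _ _)
      have hq0' : ∀ u : Fin n → U, 0 ≤ ∏ i, q (u i) := fun u => Finset.prod_nonneg fun i _ => hq0 _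
      have hqv0' : ∀ (u : Fin n → U) (a : Fin n → V k), 0 ≤ ∏ i, qv k (u i) (a i) :=
        fun u a => Finset.prod_nonneg fun i _ => hqv0 _ _ _
      calc _ ≤ ∑ u : Fin n → U, (∏ i, q (u i)) * ∑ a : Fin n → V k, (∏ i, qv k (u i) (a i)) *
            (Real.exp (-(n * (I k - δ))) * ∏ i, r' k (u i) (a i) (y i)) :=
            Finset.sum_le_sum fun u _ => mul_le_mul_of_nonneg_left
              (Finset.sum_le_sum fun a _ => mul_le_mul_of_nonneg_left (h1 u a) (hqv0' u a)) (hq0' u)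
        _ = Real.exp (-(n * (I k - δ))) * ∏ i, ∑ u, q u * ∑ a, qv k u a * r' k u a (y i) := by
            rw [← sum_pi_prod (fun i u => q u * ∑ a, qv k u a * r' k u a (y i)), Finset.mul_sum]
            refine Finset.sum_congr rfl fun u _ => ?_
            rw [Finset.prod_mul_distrib, ← sum_pi_prod (fun i a => qv k (u i) a * r' k (u i) a (y i))]
            rw [Finset.mul_sum, Finset.mul_sum, Finset.mul_sum]
            refine Finset.sum_congr rfl fun a _ => ?_
            rw [Finset.prod_mul_distrib]; ring
        _ ≤ Real.exp (-(n * (I k - δ))) * 1 := by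
            refine mul_le_mul_of_nonneg_left ?_ (Real.exp_pos _).le
            refine Finset.prod_le_one (fun i _ => ?_) (fun i _ => hr'1 k (y i))
            exact Finset.sum_nonneg fun u _ => mul_nonneg (hq0 u) (Finset.sum_nonneg fun a _ =>
              mul_nonneg (hqv0 _ _ _) (hr'0 _ _ _ _))
        _ = _ := mul_one _)
    (fun k => (Real.exp_pos _).le)
    (by
      intro k
      refine le_trans (le_of_eq ?_) (hC2 k n hn)
      simp_rw [Finset.mul_sum]
      rw [reindex5]
      refine Finset.sum_congr rfl fun t _ => ?_
      rw [← mul_assoc, ← Finset.prod_mul_distrib]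
      congr 1
      simp only [htest])
    ((∑ 𝒦, C1 𝒦) / n)
    (by
      have h1 : ∀ s u v, (if A s u v then (0:ℝ) else 1) ≤ ∑ 𝒦,
          if ∏ i, r 𝒦 (s i) (u i) (fun k => v k i) ≤ Real.exp (n * (η 𝒦 + δ)) then (0:ℝ) else 1 := by
        intro s u v
        have hnn : ∀ 𝒦 ∈ Finset.univ (α := Finset ι), (0:ℝ) ≤ 
          if ∏ i, r 𝒦 (s i) (u i) (fun k => v k i) ≤ Real.exp (n * (η 𝒦 + δ)) then (0:ℝ) else 1 := by
          intro 𝒦 _; split_ifs <;> norm_num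
        by_cases h : A s u v
        · simp only [h, if_true]; exact Finset.sum_nonneg hnn
        · simp only [h, if_false]
          rw [hAdef, not_forall] at h
          obtain ⟨𝒦, h𝒦⟩ := h
          refine le_trans (le_of_eq ?_) (Finset.single_le_sum hnn (Finset.mem_univ 𝒦))
          simp only [h𝒦, if_false]
      calc _ ≤ ∑ s : Fin n → S, ∑ u : Fin n → U, ∑ v : ∀ k, Fin n → V k, ∑ x : Fin n → X,
            (∏ i, p (s i) (u i) (fun k => v k i) (x i)) * ∑ 𝒦,
          if ∏ i, r 𝒦 (s i) (u i) (fun k => v k i) ≤ Real.exp (n * (η 𝒦 + δ)) then (0:ℝ) else 1 :=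
            Finset.sum_le_sum fun s _ => Finset.sum_le_sum fun u _ => Finset.sum_le_sum fun v _ =>
              Finset.sum_le_sum fun x _ => mul_le_mul_of_nonneg_left (h1 s u v)
                (Finset.prod_nonneg fun i _ => hp0 _ _ _ _)
        _ ≤ _ := by
            rw [reindex4]
            simp_rw [Finset.mul_sum]
            rw [Finset.sum_comm, Finset.sum_div]
            exact Finset.sum_le_sum fun 𝒦 _ => hC1 𝒦 n hn)
    L hL J hJ c hc M hM
  obtain ⟨φ, ψ, h⟩ := H
  refine ⟨φ, ψ, h.trans ?_⟩
  rw [← Finset.sum_div]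
  gcongr
  · linarith
  · linarith


lemma fib {T A : Type*} [Fintype T] [Fintype A] [DecidableEq A] (g : T → ℝ) (π : T → A) (F : A → ℝ) :
    ∑ a, (∑ t, if π t = a then g t else 0) * F a = ∑ t, g t * F (π t) := by
  simp_rw [Finset.sum_mul, ite_mul, zero_mul]
  rw [Finset.sum_comm]
  simp

lemma ite_sum_in {A B : Type*} [Fintype B] (P : A → Prop) [DecidablePred P] (a : A) (g : B → ℝ) :
    (∑ b, if P a then g b else 0) = if P a then ∑ b, g b else 0 := by
  split_ifs <;> simp

lemma sum_tuple_marg {K : ℕ} {U S X : Type*} {V : Fin K → Type*} [Fintype U] [Fintype S] [Fintype X]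
    [∀ k, Fintype (V k)] [∀ k, DecidableEq (V k)] (𝒦 : Finset (Fin K))
    (g : (∀ k, V k) → X → ℝ) (F : ((t : {k : Fin K // k ∈ 𝒦}) → V t.1) → ℝ) :
    ∑ w, (∑ v, ∑ x, if ∀ t : {k : Fin K // k ∈ 𝒦}, v t.1 = w t then g v x else 0) * F w
      = ∑ v, ∑ x, g v x * F (fun t => v t.1) := by
  have := fib (fun v => ∑ x, g v x) (fun v (t : {k : Fin K // k ∈ 𝒦}) => v t.1) F
  simp_rw [← Finset.sum_mul]
  rw [← this]
  refine Finset.sum_congr rfl fun w _ => ?_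
  congr 1
  refine Finset.sum_congr rfl fun v _ => ?_
  simp only [funext_iff]
  split_ifs <;> simp

/-- marginal on `(s,u,v_𝒦)` -/
def mB {K : ℕ} {U S X : Type*} {V : Fin K → Type*} [Fintype X]
    [∀ k, Fintype (V k)] [∀ k, DecidableEq (V k)] (p : S → U → (∀ k, V k) → X → ℝ)
    (𝒦 : Finset (Fin K)) (s : S) (u : U) (v : ∀ k, V k) : ℝ :=
  ∑ v', ∑ x, if ∀ t : {k : Fin K // k ∈ 𝒦}, v' t.1 = v t.1 then p s u v' x else 0

lemma Htuple_E {K : ℕ} {U S X : Type} {V : Fin K → Type} [Fintype U] [Fintype S] [Fintype X]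
    [∀ k, Fintype (V k)] [∀ k, DecidableEq (V k)] (p : S → U → (∀ k, V k) → X → ℝ)
    (𝒦 : Finset (Fin K)) :
    condEntropy (fun q : ((t : {k : Fin K // k ∈ 𝒦}) → V t.1) × (U × S) =>
        ∑ v : ∀ j, V j, ∑ x : X,
          if ∀ t : {k : Fin K // k ∈ 𝒦}, v t.1 = q.1 t then p q.2.2 q.2.1 v x else 0) =
    - ∑ s, ∑ u, ∑ v, ∑ x, p s u v x * Real.log (mB p 𝒦 s u v / ∑ v, ∑ x, p s u v x) := by
  unfold condEntropy
  congr 1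
  rw [Finset.sum_comm, Fintype.sum_prod_type, Finset.sum_comm]
  refine Finset.sum_congr rfl fun s _ => Finset.sum_congr rfl fun u _ => ?_
  have hA : ∑ w : (t : {k : Fin K // k ∈ 𝒦}) → V t.1, (∑ v, ∑ x, if ∀ t : {k : Fin K // k ∈ 𝒦}, v t.1 = w t then p s u v x else 0)
      = ∑ v, ∑ x, p s u v x := by
    simpa using sum_tuple_marg (U := U) (S := S) 𝒦 (p s u) (fun _ => 1)
  simp only [hA]
  exact sum_tuple_marg (U := U) (S := S) 𝒦 (p s u) (fun w => Real.log ((∑ v, ∑ x, if ∀ t : {k : Fin K // k ∈ 𝒦}, v t.1 = w t then p s u v x else 0) / ∑ v, ∑ x, p s u v x))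

/-- marginal on `(u,v_k)` -/
def mUV {K : ℕ} {U S X : Type*} {V : Fin K → Type*} [Fintype X] [Fintype S]
    [∀ k, Fintype (V k)] [∀ k, DecidableEq (V k)] (p : S → U → (∀ k, V k) → X → ℝ)
    (k : Fin K) (u : U) (a : V k) : ℝ :=
  ∑ v : ∀ j, V j, ∑ s, ∑ x, if v k = a then p s u v x else 0

/-- marginal on `u` -/
def mU {K : ℕ} {U S X : Type*} {V : Fin K → Type*} [Fintype X] [Fintype S]
    [∀ k, Fintype (V k)] (p : S → U → (∀ k, V k) → X → ℝ) (u : U) : ℝ :=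
  ∑ s, ∑ v, ∑ x, p s u v x

/-- conditional of `v_k` given `u` -/
def cVU {K : ℕ} {U S X : Type*} {V : Fin K → Type*} [Fintype X] [Fintype S]
    [∀ k, Fintype (V k)] [∀ k, DecidableEq (V k)] (p : S → U → (∀ k, V k) → X → ℝ)
    (k : Fin K) (u : U) (a : V k) : ℝ :=
  open Classical in if mU p u = 0 then 1 / (Fintype.card (V k) : ℝ) else mUV p k u a / mU p u

section
variable {K : ℕ} {U S X : Type} {V : Fin K → Type} [Fintype U] [Fintype S] [Fintype X]
    [∀ k, Fintype (V k)] [∀ k, DecidableEq (V k)] (p : S → U → (∀ k, V k) → X → ℝ)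

lemma sum_k_marg (k : Fin K) (g : (∀ k, V k) → S → X → ℝ) (F : V k → ℝ) :
    ∑ a, (∑ v : ∀ j, V j, ∑ s, ∑ x, if v k = a then g v s x else 0) * F a
      = ∑ v, ∑ s, ∑ x, g v s x * F (v k) := by
  have := fib (fun v => ∑ s, ∑ x, g v s x) (fun v => v k) F
  simp_rw [← Finset.sum_mul]
  rw [← this]
  refine Finset.sum_congr rfl fun w _ => ?_
  congr 1
  refine Finset.sum_congr rfl fun v _ => ?_
  split_ifs <;> simp

lemma sum_mUV (k : Fin K) (u : U) : ∑ a, mUV p k u a = mU p u := by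
  have := sum_k_marg (S := S) (X := X) k (fun v s x => p s u v x) (fun _ => 1)
  simp only [mul_one] at this
  unfold mUV mU
  rw [this, Finset.sum_comm]

lemma mUV_le (hp0 : ∀ s u v x, 0 ≤ p s u v x) (k : Fin K) (u : U) (a : V k) : 0 ≤ mUV p k u a :=
  Finset.sum_nonneg fun _ _ => Finset.sum_nonneg fun _ _ => Finset.sum_nonneg fun _ _ => by
    split_ifs; exacts [hp0 _ _ _ _, le_refl _]

lemma mU_nonneg (hp0 : ∀ s u v x, 0 ≤ p s u v x) (u : U) : 0 ≤ mU p u :=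
  Finset.sum_nonneg fun _ _ => Finset.sum_nonneg fun _ _ => Finset.sum_nonneg fun _ _ => hp0 _ _ _ _

lemma mU_mul_cVU (hp0 : ∀ s u v x, 0 ≤ p s u v x) (k : Fin K) (u : U) (a : V k) :
    mU p u * cVU p k u a = mUV p k u a := by
  unfold cVU
  split_ifs with h
  · have := sum_mUV p k u
    rw [h] at this ⊢
    rw [Finset.sum_eq_zero_iff_of_nonneg (fun a _ => mUV_le p hp0 k u a)] at this
    rw [this a (Finset.mem_univ _), zero_mul]
  · field_simp

lemma cVU_nonneg (hp0 : ∀ s u v x, 0 ≤ p s u v x) (k : Fin K) (u : U) (a : V k) :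
    0 ≤ cVU p k u a := by
  unfold cVU
  split_ifs with h
  · positivity
  · exact div_nonneg (mUV_le p hp0 _ _ _) (mU_nonneg p hp0 _)

lemma cVU_sum [∀ k, Nonempty (V k)] (k : Fin K) (u : U)  :
    ∑ a, cVU p k u a = 1 := by
  unfold cVU
  by_cases h : mU p u = 0
  · simp [h]
  · simp only [h, if_false]
    rw [← Finset.sum_div, sum_mUV, div_self h]

lemma mUV_pos (hp0 : ∀ s u v x, 0 ≤ p s u v x) {s u v x} (k : Fin K) (h : p s u v x ≠ 0) :
    0 < mUV p k u (v k) := by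
  unfold mUV
  have h0 : 0 < p s u v x := lt_of_le_of_ne (hp0 _ _ _ _) (Ne.symm h)
  have n3 : ∀ v' s' x', 0 ≤ (if v' k = v k then p s' u v' x' else 0) := fun v' s' x' => by
    split_ifs; exacts [hp0 _ _ _ _, le_refl _]
  refine Finset.sum_pos' (fun v' _ => Finset.sum_nonneg fun s' _ => Finset.sum_nonneg fun x' _ => n3 _ _ _) ⟨v, Finset.mem_univ _, ?_⟩
  refine Finset.sum_pos' (fun s' _ => Finset.sum_nonneg fun x' _ => n3 _ _ _) ⟨s, Finset.mem_univ _, ?_⟩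
  refine Finset.sum_pos' (fun x' _ => n3 _ _ _) ⟨x, Finset.mem_univ _, ?_⟩
  simpa using h0

lemma mU_pos (hp0 : ∀ s u v x, 0 ≤ p s u v x) {s u v x} (h : p s u v x ≠ 0) :
    0 < mU p u := by
  unfold mU
  have h0 : 0 < p s u v x := lt_of_le_of_ne (hp0 _ _ _ _) (Ne.symm h)
  refine Finset.sum_pos' (fun v' _ => Finset.sum_nonneg fun s' _ => Finset.sum_nonneg fun x' _ => hp0 _ _ _ _) ⟨s, Finset.mem_univ _, ?_⟩
  refine Finset.sum_pos' (fun s' _ => Finset.sum_nonneg fun x' _ => hp0 _ _ _ _) ⟨v, Finset.mem_univ _, ?_⟩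
  exact Finset.sum_pos' (fun x' _ => hp0 _ _ _ _) ⟨x, Finset.mem_univ _, h0⟩

lemma mSU_pos (hp0 : ∀ s u v x, 0 ≤ p s u v x) {s u v x} (h : p s u v x ≠ 0) :
    0 < ∑ v, ∑ x, p s u v x := by
  have h0 : 0 < p s u v x := lt_of_le_of_ne (hp0 _ _ _ _) (Ne.symm h)
  refine Finset.sum_pos' (fun s' _ => Finset.sum_nonneg fun x' _ => hp0 _ _ _ _) ⟨v, Finset.mem_univ _, ?_⟩
  exact Finset.sum_pos' (fun x' _ => hp0 _ _ _ _) ⟨x, Finset.mem_univ _, h0⟩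

lemma mB_nonneg (hp0 : ∀ s u v x, 0 ≤ p s u v x) (𝒦 : Finset (Fin K)) (s u v) :
    0 ≤ mB p 𝒦 s u v :=
  Finset.sum_nonneg fun _ _ => Finset.sum_nonneg fun _ _ => by
    split_ifs; exacts [hp0 _ _ _ _, le_refl _]

lemma mB_pos (hp0 : ∀ s u v x, 0 ≤ p s u v x) (𝒦 : Finset (Fin K)) {s u v x} (h : p s u v x ≠ 0) :
    0 < mB p 𝒦 s u v := by
  unfold mB
  have h0 : 0 < p s u v x := lt_of_le_of_ne (hp0 _ _ _ _) (Ne.symm h)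
  have n3 : ∀ v' x', 0 ≤ (if ∀ t : {k : Fin K // k ∈ 𝒦}, v' t.1 = v t.1 then p s u v' x' else 0) := fun v' x' => by
    split_ifs; exacts [hp0 _ _ _ _, le_refl _]
  refine Finset.sum_pos' (fun s' _ => Finset.sum_nonneg fun x' _ => n3 _ _) ⟨v, Finset.mem_univ _, ?_⟩
  refine Finset.sum_pos' (fun x' _ => n3 _ _) ⟨x, Finset.mem_univ _, ?_⟩
  simpa using h0

lemma cVU_pos (hp0 : ∀ s u v x, 0 ≤ p s u v x) {s u v x} (k : Fin K) (h : p s u v x ≠ 0) :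
    0 < cVU p k u (v k) := by
  have h1 := mUV_pos p hp0 k h
  rw [← mU_mul_cVU p hp0] at h1
  exact pos_of_mul_pos_right h1 (mU_nonneg p hp0 u)

lemma HVU_E (hp0 : ∀ s u v x, 0 ≤ p s u v x) (k : Fin K) :
    condEntropy (fun q : V k × U =>
        ∑ v : ∀ j, V j, ∑ s, ∑ x, if v k = q.1 then p s q.2 v x else 0) =
    - ∑ s, ∑ u, ∑ v, ∑ x, p s u v x * Real.log (cVU p k u (v k)) := by
  unfold condEntropy
  congr 1
  rw [Finset.sum_comm]
  rw [Finset.sum_comm (s := (Finset.univ : Finset S))]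
  refine Finset.sum_congr rfl fun u _ => ?_
  rw [Finset.sum_comm (s := (Finset.univ : Finset S))]
  rw [← sum_k_marg k (fun v s x => p s u v x) (fun a => Real.log (cVU p k u a))]
  refine Finset.sum_congr rfl fun a _ => ?_
  have h1 := sum_mUV p k u
  unfold mUV at h1
  show mUV p k u a * _ = mUV p k u a * _
  simp only
  rw [h1]
  by_cases h : mU p u = 0
  · rw [← mU_mul_cVU p hp0, h]; simp
  · rw [← mU_mul_cVU p hp0]
    congr 2
    show mUV p k u a / _ = _
    rw [← mU_mul_cVU p hp0]
    field_simp

lemma IUS_E (PS : S → ℝ) (hPS : ∀ s, ∑ u, ∑ v, ∑ x, p s u v x = PS s) :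
    mutualInfo (fun q : U × S => ∑ v : ∀ j, V j, ∑ x : X, p q.2 q.1 v x) =
    ∑ s, ∑ u, ∑ v, ∑ x, p s u v x * Real.log ((∑ v, ∑ x, p s u v x) / (mU p u * PS s)) := by
  unfold mutualInfo
  rw [Finset.sum_comm]
  refine Finset.sum_congr rfl fun s _ => Finset.sum_congr rfl fun u _ => ?_
  simp only [hPS, ← Finset.sum_mul]
  rfl

end


section
variable {K : ℕ} {U S X : Type} {V : Fin K → Type} [Fintype U] [Fintype S] [Fintype X]
    [∀ k, Fintype (V k)] [∀ k, DecidableEq (V k)] (p : S → U → (∀ k, V k) → X → ℝ)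

/-- covering density -/
def rr (PS : S → ℝ) (𝒦 : Finset (Fin K)) (s : S) (u : U) (v : ∀ k, V k) : ℝ :=
  mB p 𝒦 s u v / (PS s * mU p u * ∏ k ∈ 𝒦, cVU p k u (v k))

lemma piece_sum (𝒦 : Finset (Fin K)) (h : ∀ k, V k → ℝ) (hh : ∀ k, ∑ a, h k a = 1)
    (F : (∀ k, V k) → ℝ) (v : ∀ k, V k) :
    ∑ v' : ∀ k, V k, (∏ k ∈ 𝒦, h k (v' k)) * F (Finset.piecewise 𝒦 v v') =
      ∑ v'', if ∀ t : {k : Fin K // k ∈ 𝒦}, v'' t.1 = v t.1 then F v'' else 0 := by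
  have h1 : ∀ v' : ∀ k, V k, F (Finset.piecewise 𝒦 v v') =
      ∑ v'' : ∀ k, V k, if (Finset.piecewise 𝒦 v v') = v'' then F v'' else 0 := fun v' => by simp
  simp_rw [h1, Finset.mul_sum]
  rw [Finset.sum_comm]
  refine Finset.sum_congr rfl fun v'' _ => ?_
  by_cases hv : ∀ t : {k : Fin K // k ∈ 𝒦}, v'' t.1 = v t.1
  · rw [if_pos hv]
    have h2 : ∀ v' : ∀ k, V k, (∏ k ∈ 𝒦, h k (v' k)) * (if (Finset.piecewise 𝒦 v v') = v'' then F v'' else 0)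
        = (∏ k, if k ∈ 𝒦 then h k (v' k) else if v' k = v'' k then 1 else 0) * F v'' := by
      intro v'
      have e1 : ∏ k ∈ 𝒦, h k (v' k) = ∏ k, if k ∈ 𝒦 then h k (v' k) else 1 := by
        simp [Finset.prod_ite]
      by_cases hc : Finset.piecewise 𝒦 v v' = v''
      · rw [if_pos hc, e1]
        congr 1
        refine Finset.prod_congr rfl fun k _ => ?_
        by_cases hk : k ∈ 𝒦
        · simp [hk]
        · have := congrFun hc k
          simp [hk] at this
          simp [hk, this]
      · rw [if_neg hc, mul_zero]
        have : ∃ k, Finset.piecewise 𝒦 v v' k ≠ v'' k := by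
          by_contra hcon
          push Not at hcon
          exact hc (funext hcon)
        obtain ⟨k, hk⟩ := this
        have hk𝒦 : k ∉ 𝒦 := by
          intro hm
          apply hk
          rw [Finset.piecewise_eq_of_mem _ _ _ hm]
          exact (hv ⟨k, hm⟩).symm
        rw [Finset.piecewise_eq_of_notMem _ _ _ hk𝒦] at hk
        rw [Finset.prod_eq_zero (Finset.mem_univ k) (by simp [hk𝒦, hk]), zero_mul]
    simp_rw [h2]
    rw [← Finset.sum_mul, sum_pi_prod (fun k a => if k ∈ 𝒦 then h k a else if a = v'' k then 1 else 0)]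
    rw [Finset.prod_eq_one, one_mul]
    intro k _
    by_cases hk : k ∈ 𝒦
    · simp [hk, hh]
    · simp [hk]
  · rw [if_neg hv]
    refine Finset.sum_eq_zero fun v' _ => ?_
    rw [if_neg, mul_zero]
    intro hc
    apply hv
    rintro ⟨k, hk⟩
    rw [← hc]
    simp [hk]

lemma rr_hr [∀ k, Nonempty (V k)] (hp0 : ∀ s u v x, 0 ≤ p s u v x)
    (PS : S → ℝ) (hPS : ∀ s, ∑ u, ∑ v, ∑ x, p s u v x = PS s) (s u v 𝒦) :
    ∑ v' : ∀ k, V k, (∏ k, cVU p k u (v' k)) *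
      ((∑ x, p s u (Finset.piecewise 𝒦 v v') x) / (mU p u * ∏ k, cVU p k u (Finset.piecewise 𝒦 v v' k)))
        ≤ rr p PS 𝒦 s u v * PS s := by
  by_cases h0 : PS s = 0
  · have hz : ∀ u v x, p s u v x = 0 := by
      intro u v x
      by_contra hne
      have : 0 < PS s := by
        rw [← hPS]
        exact Finset.sum_pos' (fun u _ => Finset.sum_nonneg fun _ _ => Finset.sum_nonneg fun _ _ => hp0 _ _ _ _)
          ⟨u, Finset.mem_univ _, mSU_pos p hp0 hne⟩
      exact this.ne' h0
    simp [hz, h0]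
  · have e : rr p PS 𝒦 s u v * PS s = mB p 𝒦 s u v * (1 / (mU p u * ∏ k ∈ 𝒦, cVU p k u (v k))) := by
      unfold rr; rw [mul_assoc (PS s)]; 
      generalize mU p u * ∏ k ∈ 𝒦, cVU p k u (v k) = d
      rw [div_mul_eq_mul_div, mul_comm _ (PS s), mul_div_mul_left _ _ h0, mul_one_div]
    have hB : mB p 𝒦 s u v = ∑ v' : ∀ k, V k, (∏ k ∈ 𝒦, cVU p k u (v' k)) * ∑ x, p s u (Finset.piecewise 𝒦 v v') x := by
      rw [piece_sum 𝒦 (fun k a => cVU p k u a) (fun k => cVU_sum p k u) (fun v => ∑ x, p s u v x) v]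
      unfold mB
      refine Finset.sum_congr rfl fun v' _ => ?_
      split_ifs <;> simp
    rw [e, hB, Finset.sum_mul]
    refine Finset.sum_le_sum fun v' _ => ?_
    have e1 : ∏ k, cVU p k u (v' k) = (∏ k ∈ 𝒦, cVU p k u (v' k)) * ∏ k ∈ 𝒦ᶜ, cVU p k u (v' k) :=
      (Finset.prod_mul_prod_compl _ _).symm
    have e2 : ∏ k, cVU p k u (Finset.piecewise 𝒦 v v' k) = (∏ k ∈ 𝒦, cVU p k u (v k)) * ∏ k ∈ 𝒦ᶜ, cVU p k u (v' k) := by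
      rw [← Finset.prod_mul_prod_compl 𝒦]
      congr 1
      · exact Finset.prod_congr rfl fun k hk => by rw [Finset.piecewise_eq_of_mem _ _ _ hk]
      · exact Finset.prod_congr rfl fun k hk => by
          rw [Finset.piecewise_eq_of_notMem _ _ _ (Finset.mem_compl.1 hk)]
    rw [e1, e2]
    have hnA : 0 ≤ ∏ k ∈ 𝒦, cVU p k u (v' k) := Finset.prod_nonneg fun k _ => cVU_nonneg p hp0 _ _ _
    have hnB : 0 ≤ mU p u * ∏ k ∈ 𝒦, cVU p k u (v k) := mul_nonneg (mU_nonneg p hp0 u) (Finset.prod_nonneg fun k _ => cVU_nonneg p hp0 _ _ _)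
    have hnF : 0 ≤ ∑ x, p s u (Finset.piecewise 𝒦 v v') x := Finset.sum_nonneg fun x _ => hp0 _ _ _ _
    rw [← mul_assoc (mU p u)]
    generalize mU p u * ∏ k ∈ 𝒦, cVU p k u (v k) = d at *
    generalize ∏ k ∈ 𝒦, cVU p k u (v' k) = a at *
    generalize ∏ k ∈ 𝒦ᶜ, cVU p k u (v' k) = b at *
    generalize ∑ x, p s u (Finset.piecewise 𝒦 v v') x = F at *
    by_cases hb : b = 0
    · subst hb; simp; positivity
    · apply le_of_eq
      rw [mul_assoc a b, mul_div_assoc', mul_comm d b, mul_div_mul_left _ _ hb, mul_one_div, mul_div_assoc]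

lemma PS_pos (hp0 : ∀ s u v x, 0 ≤ p s u v x)
    (PS : S → ℝ) (hPS : ∀ s, ∑ u, ∑ v, ∑ x, p s u v x = PS s) {s u v x} (h : p s u v x ≠ 0) :
    0 < PS s := by
  rw [← hPS]
  exact Finset.sum_pos' (fun u _ => Finset.sum_nonneg fun _ _ => Finset.sum_nonneg fun _ _ => hp0 _ _ _ _)
          ⟨u, Finset.mem_univ _, mSU_pos p hp0 h⟩

lemma rr_pos (hp0 : ∀ s u v x, 0 ≤ p s u v x)
    (PS : S → ℝ) (hPS : ∀ s, ∑ u, ∑ v, ∑ x, p s u v x = PS s) (𝒦) {s u v x} (h : p s u v x ≠ 0) :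
    0 < rr p PS 𝒦 s u v :=
  div_pos (mB_pos p hp0 𝒦 h) (mul_pos (mul_pos (PS_pos p hp0 PS hPS h) (mU_pos p hp0 h))
    (Finset.prod_pos fun k _ => cVU_pos p hp0 k h))

lemma rr_log (hp0 : ∀ s u v x, 0 ≤ p s u v x)
    (PS : S → ℝ) (hPS : ∀ s, ∑ u, ∑ v, ∑ x, p s u v x = PS s) (𝒦) (s u v x) :
    p s u v x * Real.log (rr p PS 𝒦 s u v) =
      p s u v x * Real.log ((∑ v, ∑ x, p s u v x) / (mU p u * PS s))
      + p s u v x * Real.log (mB p 𝒦 s u v / ∑ v, ∑ x, p s u v x)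
      - ∑ k ∈ 𝒦, p s u v x * Real.log (cVU p k u (v k)) := by
  by_cases h : p s u v x = 0
  · simp [h]
  · have h1 := mB_pos p hp0 𝒦 h
    have h2 := PS_pos p hp0 PS hPS h
    have h3 := mU_pos p hp0 h
    have h4 := mSU_pos p hp0 h
    have h5 : ∀ k, 0 < cVU p k u (v k) := fun k => cVU_pos p hp0 k h
    have h6 : 0 < ∏ k ∈ 𝒦, cVU p k u (v k) := Finset.prod_pos fun k _ => h5 k
    unfold rr
    rw [← Finset.mul_sum, ← Real.log_prod (fun k _ => (h5 k).ne'), ← mul_add, ← mul_sub]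
    rw [Real.log_div h1.ne' (by positivity), Real.log_div h4.ne' (by positivity), Real.log_div h1.ne' h4.ne',
      Real.log_mul (by positivity) h6.ne', Real.log_mul h2.ne' h3.ne', Real.log_mul h3.ne' h2.ne']
    ring

lemma rr_eta (hp0 : ∀ s u v x, 0 ≤ p s u v x)
    (PS : S → ℝ) (hPS : ∀ s, ∑ u, ∑ v, ∑ x, p s u v x = PS s) (𝒦 : Finset (Fin K)) :
    ∑ s, ∑ u, ∑ v, ∑ x, p s u v x * Real.log (rr p PS 𝒦 s u v) =
      mutualInfo (fun q : U × S => ∑ v : ∀ j, V j, ∑ x : X, p q.2 q.1 v x)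
      + ∑ k ∈ 𝒦, condEntropy (fun q : V k × U =>
        ∑ v : ∀ j, V j, ∑ s, ∑ x, if v k = q.1 then p s q.2 v x else 0)
      - condEntropy (fun q : ((t : {k : Fin K // k ∈ 𝒦}) → V t.1) × (U × S) =>
        ∑ v : ∀ j, V j, ∑ x : X,
          if ∀ t : {k : Fin K // k ∈ 𝒦}, v t.1 = q.1 t then p q.2.2 q.2.1 v x else 0) := by
  rw [IUS_E p PS hPS, Htuple_E]
  simp_rw [HVU_E p hp0, rr_log p hp0 PS hPS, Finset.sum_sub_distrib, Finset.sum_add_distrib]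
  rw [Finset.sum_neg_distrib]
  have : ∑ s, ∑ u, ∑ v, ∑ x, ∑ k ∈ 𝒦, p s u v x * Real.log (cVU p k u (v k)) =
    ∑ k ∈ 𝒦, ∑ s, ∑ u, ∑ v, ∑ x, p s u v x * Real.log (cVU p k u (v k)) := by
    rw [Finset.sum_comm (s := 𝒦)]
    refine Finset.sum_congr rfl fun s _ => ?_
    rw [Finset.sum_comm (s := 𝒦)]
    refine Finset.sum_congr rfl fun u _ => ?_
    rw [Finset.sum_comm (s := 𝒦)]
    refine Finset.sum_congr rfl fun v _ => ?_
    rw [Finset.sum_comm (s := 𝒦)]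
  rw [this]
  ring

lemma gibbs {T : Type*} [Fintype T] (p f : T → ℝ) (hp0 : ∀ t, 0 ≤ p t) (hp1 : ∑ t, p t = 1)
    (hf : ∀ t, p t ≠ 0 → 0 < f t) (h : ∑ t, p t * (f t)⁻¹ ≤ 1) : 0 ≤ ∑ t, p t * Real.log (f t) := by
  have : ∑ t, p t * (1 - (f t)⁻¹) ≤ ∑ t, p t * Real.log (f t) := by
    refine Finset.sum_le_sum fun t _ => ?_
    by_cases h0 : p t = 0
    · simp [h0]
    · exact mul_le_mul_of_nonneg_left (Real.one_sub_inv_le_log_of_pos (hf t h0)) (hp0 t)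
  refine le_trans ?_ this
  simp_rw [mul_sub, mul_one, Finset.sum_sub_distrib, hp1]
  linarith

lemma gibbs4 (f : S → U → (∀ k, V k) → ℝ) (hp0 : ∀ s u v x, 0 ≤ p s u v x)
    (hp1 : ∑ s, ∑ u, ∑ v, ∑ x, p s u v x = 1)
    (hf : ∀ s u v x, p s u v x ≠ 0 → 0 < f s u v) (h : ∑ s, ∑ u, ∑ v, ∑ x, p s u v x * (f s u v)⁻¹ ≤ 1) :
    0 ≤ ∑ s, ∑ u, ∑ v, ∑ x, p s u v x * Real.log (f s u v) := by
  have := gibbs (T := S × U × (∀ k, V k) × X) (fun t => p t.1 t.2.1 t.2.2.1 t.2.2.2)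
    (fun t => f t.1 t.2.1 t.2.2.1) (fun t => hp0 _ _ _ _) 
    (by simp_rw [Fintype.sum_prod_type]; exact hp1) (fun t ht => hf _ _ _ _ ht)
    (by simp_rw [Fintype.sum_prod_type]; exact h)
  simp_rw [Fintype.sum_prod_type] at this
  exact this

lemma mU_sum : ∑ u, mU p u = ∑ s, ∑ u, ∑ v, ∑ x, p s u v x := by
  unfold mU; rw [Finset.sum_comm]

lemma IUS_nonneg (hp0 : ∀ s u v x, 0 ≤ p s u v x)
    (PS : S → ℝ) (hPS : ∀ s, ∑ u, ∑ v, ∑ x, p s u v x = PS s) (hPS1 : ∑ s, PS s = 1) :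
    0 ≤ mutualInfo (fun q : U × S => ∑ v : ∀ j, V j, ∑ x : X, p q.2 q.1 v x) := by
  rw [IUS_E p PS hPS]
  have hPS0 : ∀ s, 0 ≤ PS s := fun s => by
    rw [← hPS]; exact Finset.sum_nonneg fun u _ => Finset.sum_nonneg fun _ _ => Finset.sum_nonneg fun _ _ => hp0 _ _ _ _
  refine gibbs4 p (fun s u v => (∑ v, ∑ x, p s u v x) / (mU p u * PS s)) hp0 (by simp_rw [hPS, hPS1])
    (fun s u v x h => div_pos (mSU_pos p hp0 h) (mul_pos (mU_pos p hp0 h) (PS_pos p hp0 PS hPS h))) ?_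
  have : ∀ s u, ∑ v, ∑ x, p s u v x * ((∑ v, ∑ x, p s u v x) / (mU p u * PS s))⁻¹ ≤ mU p u * PS s := by
    intro s u
    simp_rw [← Finset.sum_mul]
    generalize ∑ v, ∑ x, p s u v x = A
    have : 0 ≤ mU p u * PS s := mul_nonneg (mU_nonneg p hp0 u) (hPS0 s)
    by_cases hA : A = 0
    · simp [hA, this]
    · rw [inv_div, mul_div_cancel₀ _ hA]
  refine le_trans (Finset.sum_le_sum fun s _ => Finset.sum_le_sum fun u _ => this s u) ?_
  simp_rw [← Finset.sum_mul, ← Finset.mul_sum, mU_sum, hPS, hPS1]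
  norm_num

lemma H_cond (hp0 : ∀ s u v x, 0 ≤ p s u v x) [∀ k, Nonempty (V k)]
    (hp1 : ∑ s, ∑ u, ∑ v, ∑ x, p s u v x = 1) (k : Fin K) :
    condEntropy (fun q : ((t : {j : Fin K // j ∈ ({k} : Finset (Fin K))}) → V t.1) × (U × S) =>
        ∑ v : ∀ j, V j, ∑ x : X,
          if ∀ t : {j : Fin K // j ∈ ({k} : Finset (Fin K))}, v t.1 = q.1 t then p q.2.2 q.2.1 v x else 0) ≤ 
    condEntropy (fun q : V k × U =>
        ∑ v : ∀ j, V j, ∑ s, ∑ x, if v k = q.1 then p s q.2 v x else 0) := by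
  rw [Htuple_E, HVU_E p hp0]
  have G := gibbs4 p (fun s u v => (mB p {k} s u v / ∑ v, ∑ x, p s u v x) / cVU p k u (v k)) hp0 hp1
    (fun s u v x h => div_pos (div_pos (mB_pos p hp0 _ h) (mSU_pos p hp0 h)) (cVU_pos p hp0 k h)) ?_
  · have : ∀ s u v x, p s u v x * Real.log ((mB p {k} s u v / ∑ v, ∑ x, p s u v x) / cVU p k u (v k)) =
        p s u v x * Real.log (mB p {k} s u v / ∑ v, ∑ x, p s u v x) - p s u v x * Real.log (cVU p k u (v k)) := by
      intro s u v x
      by_cases h : p s u v x = 0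
      · simp [h]
      · rw [Real.log_div (div_pos (mB_pos p hp0 _ h) (mSU_pos p hp0 h)).ne' (cVU_pos p hp0 k h).ne', mul_sub]
    simp_rw [this, Finset.sum_sub_distrib] at G
    linarith
  · have : ∀ s u, ∑ v, ∑ x, p s u v x * ((mB p {k} s u v / ∑ v, ∑ x, p s u v x) / cVU p k u (v k))⁻¹ ≤ 
        ∑ v, ∑ x, p s u v x := by
      intro s u
      have hA : 0 ≤ ∑ v, ∑ x, p s u v x := Finset.sum_nonneg fun _ _ => Finset.sum_nonneg fun _ _ => hp0 _ _ _ _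
      generalize hAd : ∑ v, ∑ x, p s u v x = A at *
      have hB : ∀ v, mB p {k} s u v = ∑ v' : ∀ j, V j, if v' k = v k then ∑ x, p s u v' x else 0 := by
        intro v
        unfold mB
        refine Finset.sum_congr rfl fun v' _ => ?_
        by_cases hv : v' k = v k
        · simp [hv]
        · simp [hv]
      simp_rw [← Finset.sum_mul, hB]
      rw [← fib (fun v => ∑ x, p s u v x) (fun v => v k) (fun a => (((∑ v' : ∀ j, V j, if v' k = a then ∑ x, p s u v' x else 0)/ A) / cVU p k u a)⁻¹)]
      calc _ ≤ ∑ a, A * cVU p k u a := by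
            refine Finset.sum_le_sum fun a _ => ?_
            have hc := cVU_nonneg p hp0 k u a
            generalize (∑ v' : ∀ j, V j, if v' k = a then ∑ x, p s u v' x else 0) = B
            generalize cVU p k u a = c at *
            by_cases hB : B = 0
            · subst hB; simp; positivity
            · apply le_of_eq
              rw [inv_div, div_div_eq_mul_div, mul_div_cancel₀ _ hB, mul_comm]
        _ = A := by rw [← Finset.mul_sum, cVU_sum, mul_one]
    exact le_trans (Finset.sum_le_sum fun s _ => Finset.sum_le_sum fun u _ => this s u) hp1.le

end


section
variable {K : ℕ} {U S X Y : Type} {V : Fin K → Type} [Fintype U] [Fintype S] [Fintype X] [Fintype Y]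
    [∀ k, Fintype (V k)] [∀ k, DecidableEq (V k)] (p : S → U → (∀ k, V k) → X → ℝ)
    (W : Fin K → X → S → Y → ℝ)

/-- joint pmf of `((u,v_k),y)` -/
def mY (k : Fin K) (q : (U × V k) × Y) : ℝ :=
  ∑ v : ∀ j, V j, ∑ s, ∑ x, if v k = q.1.2 then p s q.1.1 v x * W k x s q.2 else 0

/-- packing density -/
def rp (k : Fin K) (u : U) (a : V k) (y : Y) : ℝ :=
  mY p W k ((u, a), y) / ((∑ y', mY p W k ((u, a), y')) * ∑ ua, mY p W k (ua, y))

lemma mY_nonneg (hp0 : ∀ s u v x, 0 ≤ p s u v x) (hW0 : ∀ k x s y, 0 ≤ W k x s y) (k q) :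
    0 ≤ mY p W k q := 
  Finset.sum_nonneg fun _ _ => Finset.sum_nonneg fun _ _ => Finset.sum_nonneg fun _ _ => by
    split_ifs; exacts [mul_nonneg (hp0 _ _ _ _) (hW0 _ _ _ _), le_refl _]

lemma mY_pos (hp0 : ∀ s u v x, 0 ≤ p s u v x) (hW0 : ∀ k x s y, 0 ≤ W k x s y) {k s u v x y}
    (h : p s u v x * W k x s y ≠ 0) : 0 < mY p W k ((u, v k), y) := by
  unfold mY
  have h0 : 0 < p s u v x * W k x s y := lt_of_le_of_ne (mul_nonneg (hp0 _ _ _ _) (hW0 _ _ _ _)) (Ne.symm h)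
  have n3 : ∀ v' s' x', 0 ≤ (if v' k = v k then p s' u v' x' * W k x' s' y else 0) := fun v' s' x' => by
    split_ifs; exacts [mul_nonneg (hp0 _ _ _ _) (hW0 _ _ _ _), le_refl _]
  refine Finset.sum_pos' (fun v' _ => Finset.sum_nonneg fun s' _ => Finset.sum_nonneg fun x' _ => n3 _ _ _) ⟨v, Finset.mem_univ _, ?_⟩
  refine Finset.sum_pos' (fun s' _ => Finset.sum_nonneg fun x' _ => n3 _ _ _) ⟨s, Finset.mem_univ _, ?_⟩
  refine Finset.sum_pos' (fun x' _ => n3 _ _ _) ⟨x, Finset.mem_univ _, ?_⟩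
  simpa using h0

lemma mY_sum (hW1 : ∀ k x s, ∑ y, W k x s y = 1) (k u a) :
    ∑ y, mY p W k ((u, a), y) = mUV p k u a := by
  unfold mY mUV
  rw [Finset.sum_comm]
  refine Finset.sum_congr rfl fun v _ => ?_
  rw [Finset.sum_comm]
  refine Finset.sum_congr rfl fun s _ => ?_
  rw [Finset.sum_comm]
  refine Finset.sum_congr rfl fun x _ => ?_
  by_cases h : v k = a
  · simp [h, ← Finset.mul_sum, hW1]
  · simp [h]

lemma rp_le (hp0 : ∀ s u v x, 0 ≤ p s u v x) (hW0 : ∀ k x s y, 0 ≤ W k x s y)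
    (hW1 : ∀ k x s, ∑ y, W k x s y = 1) (k y) :
    ∑ u, mU p u * ∑ a, cVU p k u a * rp p W k u a y ≤ 1 := by
  simp_rw [Finset.mul_sum, ← mul_assoc, mU_mul_cVU p hp0]
  have hm : ∀ q, 0 ≤ mY p W k q := mY_nonneg p W hp0 hW0 k
  have hc : 0 ≤ ∑ ua, mY p W k (ua, y) := Finset.sum_nonneg fun _ _ => hm _
  calc _ ≤ ∑ u, ∑ a, mY p W k ((u, a), y) / ∑ ua, mY p W k (ua, y) := by
        refine Finset.sum_le_sum fun u _ => Finset.sum_le_sum fun a _ => ?_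
        unfold rp
        rw [mY_sum p W hW1]
        have h1 := hm ((u, a), y)
        generalize ∑ ua, mY p W k (ua, y) = c at *
        generalize mY p W k ((u, a), y) = b at *
        generalize mUV p k u a = d
        by_cases hd : d = 0
        · subst hd; simp; positivity
        · apply le_of_eq
          rw [mul_div_assoc', mul_div_mul_left _ _ hd]
    _ = (∑ ua, mY p W k (ua, y)) / ∑ ua, mY p W k (ua, y) := by
        simp_rw [← Finset.sum_div, Fintype.sum_prod_type]
    _ ≤ 1 := div_self_le_one _

lemma rp_nonneg (hp0 : ∀ s u v x, 0 ≤ p s u v x) (hW0 : ∀ k x s y, 0 ≤ W k x s y) (k u a y) :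
    0 ≤ rp p W k u a y := by
  have hm : ∀ q, 0 ≤ mY p W k q := mY_nonneg p W hp0 hW0 k
  exact div_nonneg (hm _) (mul_nonneg (Finset.sum_nonneg fun _ _ => hm _) (Finset.sum_nonneg fun _ _ => hm _))

lemma rp_pos (hp0 : ∀ s u v x, 0 ≤ p s u v x) (hW0 : ∀ k x s y, 0 ≤ W k x s y) (k s u v x y)
    (h : p s u v x * W k x s y ≠ 0) : 0 < rp p W k u (v k) y := by
  have hm : ∀ q, 0 ≤ mY p W k q := mY_nonneg p W hp0 hW0 k
  have h1 := mY_pos p W hp0 hW0 h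
  refine div_pos h1 (mul_pos ?_ ?_)
  · exact Finset.sum_pos' (fun _ _ => hm _) ⟨y, Finset.mem_univ _, h1⟩
  · exact Finset.sum_pos' (fun _ _ => hm _) ⟨(u, v k), Finset.mem_univ _, h1⟩

lemma rp_I (k : Fin K) :
    ∑ s, ∑ u, ∑ v, ∑ x, ∑ y, p s u v x * W k x s y * Real.log (rp p W k u (v k) y) =
      mutualInfo (fun q : (U × V k) × Y => ∑ v : ∀ j, V j, ∑ s, ∑ x, if v k = q.1.2 then p s q.1.1 v x * W k x s q.2 else 0) := by
  show _ = mutualInfo (mY p W k)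
  unfold mutualInfo
  rw [Fintype.sum_prod_type, Finset.sum_comm]
  refine Finset.sum_congr rfl fun u _ => ?_
  rw [Finset.sum_comm (s := (Finset.univ : Finset (V k)))]
  have : ∀ y, ∑ a, mY p W k ((u, a), y) * Real.log (rp p W k u a y) = 
     ∑ v, ∑ s, ∑ x, p s u v x * W k x s y * Real.log (rp p W k u (v k) y) := fun y =>
    sum_k_marg k (fun v s x => p s u v x * W k x s y) (fun a => Real.log (rp p W k u a y))
  refine Eq.trans ?_ (Finset.sum_congr rfl fun y _ => (this y).symm)
  rw [Finset.sum_comm (s := (Finset.univ : Finset Y)), Finset.sum_comm (s := (Finset.univ : Finset S))]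
  refine Finset.sum_congr rfl fun v _ => ?_
  rw [Finset.sum_comm (s := (Finset.univ : Finset Y))]
  refine Finset.sum_congr rfl fun s _ => ?_
  rw [Finset.sum_comm (s := (Finset.univ : Finset Y))]

open Classical in
theorem n_shot' [∀ k, Nonempty (V k)] [Nonempty X] (hp0 : ∀ s u v x, 0 ≤ p s u v x)
    (PS : S → ℝ) (hPS : ∀ s, ∑ u, ∑ v, ∑ x, p s u v x = PS s) (hPS1 : ∑ s, PS s = 1)
    (hW0 : ∀ k x s y, 0 ≤ W k x s y) (hW1 : ∀ k x s, ∑ y, W k x s y = 1)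
    (η : Finset (Fin K) → ℝ) (hη : ∀ 𝒦, ∑ s, ∑ u, ∑ v, ∑ x, p s u v x * Real.log (rr p PS 𝒦 s u v) = η 𝒦)
    (I : Fin K → ℝ)
    (hI : ∀ k, ∑ s, ∑ u, ∑ v, ∑ x, ∑ y, p s u v x * W k x s y * Real.log (rp p W k u (v k) y) = I k)
    (δ : ℝ) (hδ : 0 < δ) :
    ∃ C : ℝ, ∀ n : ℕ, 0 < n → ∀ L : ℕ, 0 < L → ∀ J : Fin K → ℕ, (∀ k, 0 < J k) → ∀ c : ℝ, 0 < c →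
      ∀ M : ℕ, 0 < M → 
    ∃ (φ : Fin M → (Fin n → S) → (Fin n → X)) (ψ : (Fin n → Y) → Fin M),
      ∑ m, ∑ k, ∑ s, (∏ i, PS (s i)) * ∑ y : Fin n → Y, (∏ i, W k (φ m s i) (s i) (y i)) *
          (if ψ y ≠ m then 1 else 0) ≤
        M * (C / n + K * (M * ∑ k, L * (J k * Real.exp (-(n * (I k - δ))))) +
          K * (C / n + (c +
            (∑ 𝒦, Real.exp (n * (η 𝒦 + δ)) / ∏ k ∈ 𝒦, (J k : ℝ)) / (L * c)))) := by
  have := n_shot p hp0 PS hPS hPS1 W hW0 hW1 (mU p) (mU_nonneg p hp0)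
    (by rw [mU_sum]; simp_rw [hPS, hPS1]) (cVU p) (cVU_nonneg p hp0) (fun k u => cVU_sum p k u)
    (by
      intro s u v x h
      by_contra hne
      exact (mul_pos (mU_pos p hp0 hne) (Finset.prod_pos fun k _ => cVU_pos p hp0 k hne)).ne' h)
    (rr p PS) (fun s u v 𝒦 => by
      have := rr_hr p hp0 PS hPS s u v 𝒦
      convert this using 1)
    (fun 𝒦 s u v x h => rr_pos p hp0 PS hPS 𝒦 h) η hη (rp p W)
    (rp_nonneg p W hp0 hW0) (rp_le p W hp0 hW0 hW1) (rp_pos p W hp0 hW0) I hI δ hδ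
  simpa only [Fintype.card_fin] using this

end

lemma expurg {M : ℕ} (E : Fin (2 * M) → ℝ) (hE : ∀ m, 0 ≤ E m) (ε : ℝ) (hε : 0 < ε)
    (h : ∑ m, E m ≤ (2 * M : ℕ) * (ε / 2)) :
    ∃ e : Fin M → Fin (2 * M), Function.Injective e ∧ ∀ m, E (e m) ≤ ε := by
  classical
  set G := Finset.univ.filter (fun m => E m ≤ ε) with hG
  set B := Finset.univ.filter (fun m => ¬ E m ≤ ε) with hB
  have hc : G.card + B.card = 2 * M := by
    have := Finset.card_filter_add_card_filter_not (s := (Finset.univ : Finset (Fin (2 * M)))) (fun m => E m ≤ ε)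
    rw [Finset.card_univ, Fintype.card_fin] at this
    exact this
  have hb : (B.card : ℝ) * ε ≤ M * ε := by
    have h1 : (B.card : ℝ) * ε ≤ ∑ m ∈ B, E m := by
      rw [← nsmul_eq_mul]
      refine Finset.card_nsmul_le_sum _ _ _ fun m hm => ?_
      have := (Finset.mem_filter.1 hm).2
      exact (not_le.1 this).le
    have h2 : ∑ m ∈ B, E m ≤ ∑ m, E m :=
      Finset.sum_le_sum_of_subset_of_nonneg (Finset.filter_subset _ _) (fun _ _ _ => hE _)
    push_cast at h
    linarith
  have hb' : B.card ≤ M := by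
    have := le_of_mul_le_mul_right hb hε
    exact_mod_cast this
  have hg : M ≤ G.card := by omega
  refine ⟨fun m => G.orderEmbOfFin rfl (Fin.castLE hg m), ?_, ?_⟩
  · exact (G.orderEmbOfFin rfl).injective.comp (Fin.castLE_injective hg)
  · intro m
    have := Finset.orderEmbOfFin_mem G rfl (Fin.castLE hg m)
    exact (Finset.mem_filter.1 this).2

lemma ceil_exp (t : ℝ) (ht : 0 ≤ t) : (⌈Real.exp t⌉₊ : ℝ) ≤ 2 * Real.exp t := by
  have h1 : 1 ≤ Real.exp t := Real.one_le_exp ht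
  have := Nat.ceil_lt_add_one (Real.exp_pos t).le
  linarith

lemma rate_bound {K : ℕ} (hK : 1 ≤ K) (η : Finset (Fin K) → ℝ) (I : Fin K → ℝ) (a ρ δ C ε : ℝ) (ha : 0 ≤ a)
    (hρ : 0 < ρ) (hδ : 0 < δ) (hε : 0 < ε) (hT : ∀ k, 0 ≤ I k - ρ - a - 4 * δ)
    (hη : ∀ 𝒦, η 𝒦 ≤ a + ∑ k ∈ 𝒦, (I k - ρ - a - 4 * δ)) :
    ∃ c : ℝ, 0 < c ∧ ∃ n₀ : ℕ, ∀ n ≥ n₀, 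
      C / n + K * ((2 * ⌈Real.exp (n * ρ)⌉₊ : ℕ) * ∑ k, (⌈Real.exp (n * (a + 2 * δ))⌉₊ : ℝ) *
        ((⌈Real.exp (n * (I k - ρ - a - 4 * δ))⌉₊ : ℝ) * Real.exp (-(n * (I k - δ))))) +
          K * (C / n + (c +
            (∑ 𝒦, Real.exp (n * (η 𝒦 + δ)) / ∏ k ∈ 𝒦, (⌈Real.exp (n * (I k - ρ - a - 4 * δ))⌉₊ : ℝ)) /
              ((⌈Real.exp (n * (a + 2 * δ))⌉₊ : ℝ) * c))) ≤ ε / 2 := by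
  have hKr : (0:ℝ) < K := by exact_mod_cast hK
  refine ⟨ε / (4 * K), by positivity, ?_⟩
  set c := ε / (4 * K) with hc
  have hcpos : 0 < c := by positivity
  -- limit
  have hexp : Filter.Tendsto (fun n : ℕ => Real.exp (-(n * δ))) Filter.atTop (nhds 0) := by
    apply Real.tendsto_exp_neg_atTop_nhds_zero.comp
    exact tendsto_natCast_atTop_atTop.atTop_mul_const hδ
  have hCn : Filter.Tendsto (fun n : ℕ => C / (n:ℝ)) Filter.atTop (nhds 0) :=
    tendsto_const_div_atTop_nhds_zero_nat C
  have hlim : Filter.Tendsto (fun n : ℕ => C / (n:ℝ) + K * (K * (16 * Real.exp (-(n * δ)))) +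
      K * (C / n + (c + ((2:ℝ) ^ K * Real.exp (-(n * δ))) / c))) Filter.atTop
      (nhds (0 + K * (K * (16 * 0)) + K * (0 + (c + ((2:ℝ) ^ K * 0) / c)))) := by
    refine (hCn.add (((hexp.const_mul 16).const_mul _).const_mul _)).add ?_
    exact (hCn.add (((hexp.const_mul _).div_const _).const_add _)).const_mul _
  have hval : (0 + K * (K * (16 * 0)) + K * (0 + (c + ((2:ℝ) ^ K * 0) / c))) < ε / 2 := by
    have : (K:ℝ) * c = ε / 4 := by rw [hc]; field_simp
    simp [this]; linarith
  obtain ⟨n₀, hn₀⟩ := Filter.eventually_atTop.1 (hlim.eventually (gt_mem_nhds hval))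
  refine ⟨n₀, fun n hn => le_trans ?_ (hn₀ n hn).le⟩
  have hn0 : (0:ℝ) ≤ n := Nat.cast_nonneg n
  have hL1 : (⌈Real.exp (n * (a + 2 * δ))⌉₊ : ℝ) ≤ 2 * Real.exp (n * (a + 2 * δ)) := ceil_exp _ (by positivity)
  have hL2 : Real.exp (n * (a + 2 * δ)) ≤ (⌈Real.exp (n * (a + 2 * δ))⌉₊ : ℝ) := Nat.le_ceil _
  have hM1 : (⌈Real.exp (n * ρ)⌉₊ : ℝ) ≤ 2 * Real.exp (n * ρ) := ceil_exp _ (by positivity)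
  have hJ1 : ∀ k, (⌈Real.exp (n * (I k - ρ - a - 4 * δ))⌉₊ : ℝ) ≤ 2 * Real.exp (n * (I k - ρ - a - 4 * δ)) :=
    fun k => ceil_exp _ (mul_nonneg hn0 (hT k))
  have hJ2 : ∀ k, Real.exp (n * (I k - ρ - a - 4 * δ)) ≤ (⌈Real.exp (n * (I k - ρ - a - 4 * δ))⌉₊ : ℝ) :=
    fun k => Nat.le_ceil _
  have A1 : ((2 * ⌈Real.exp (n * ρ)⌉₊ : ℕ) : ℝ) * ∑ k, (⌈Real.exp (n * (a + 2 * δ))⌉₊ : ℝ) *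
        ((⌈Real.exp (n * (I k - ρ - a - 4 * δ))⌉₊ : ℝ) * Real.exp (-(n * (I k - δ)))) ≤ K * (16 * Real.exp (-(n * δ))) := by
    rw [Finset.mul_sum]
    have : ∀ k ∈ (Finset.univ : Finset (Fin K)), ((2 * ⌈Real.exp (n * ρ)⌉₊ : ℕ) : ℝ) * ((⌈Real.exp (n * (a + 2 * δ))⌉₊ : ℝ) *
        ((⌈Real.exp (n * (I k - ρ - a - 4 * δ))⌉₊ : ℝ) * Real.exp (-(n * (I k - δ))))) ≤ 16 * Real.exp (-(n * δ)) := by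
      intro k _
      push_cast
      calc _ ≤ (2 * (2 * Real.exp (n * ρ))) * ((2 * Real.exp (n * (a + 2 * δ))) * ((2 * Real.exp (n * (I k - ρ - a - 4 * δ))) * Real.exp (-(n * (I k - δ))))) := by
            have := hJ1 k
            gcongr
        _ = 16 * (Real.exp (n * ρ) * (Real.exp (n * (a + 2 * δ)) * (Real.exp (n * (I k - ρ - a - 4 * δ)) * Real.exp (-(n * (I k - δ)))))) := by ring
        _ = 16 * Real.exp (-(n * δ)) := by
            rw [← Real.exp_add, ← Real.exp_add, ← Real.exp_add]
            congr 2; ring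
    have := Finset.sum_le_card_nsmul _ _ _ this
    simpa using this
  have A2 : (∑ 𝒦, Real.exp (n * (η 𝒦 + δ)) / ∏ k ∈ 𝒦, (⌈Real.exp (n * (I k - ρ - a - 4 * δ))⌉₊ : ℝ)) /
              ((⌈Real.exp (n * (a + 2 * δ))⌉₊ : ℝ) * c) ≤ ((2:ℝ) ^ K * Real.exp (-(n * δ))) / c := by
    rw [← div_div]
    refine div_le_div_of_nonneg_right ?_ hcpos.le
    rw [Finset.sum_div]
    have : ∀ 𝒦 ∈ (Finset.univ : Finset (Finset (Fin K))), Real.exp (n * (η 𝒦 + δ)) / (∏ k ∈ 𝒦, (⌈Real.exp (n * (I k - ρ - a - 4 * δ))⌉₊ : ℝ)) / (⌈Real.exp (n * (a + 2 * δ))⌉₊ : ℝ) ≤ Real.exp (-(n * δ)) := by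
      intro 𝒦 _
      rw [div_div, div_le_iff₀ (mul_pos (Finset.prod_pos fun k _ => lt_of_lt_of_le (Real.exp_pos _) (hJ2 k)) (lt_of_lt_of_le (Real.exp_pos _) hL2))]
      calc Real.exp (n * (η 𝒦 + δ)) ≤ Real.exp (-(n * δ) + (∑ k ∈ 𝒦, n * (I k - ρ - a - 4 * δ) + n * (a + 2 * δ))) := by
            apply Real.exp_le_exp.2
            rw [← Finset.mul_sum]
            have := mul_le_mul_of_nonneg_left (hη 𝒦) hn0
            nlinarith
        _ = Real.exp (-(n * δ)) * ((∏ k ∈ 𝒦, Real.exp (n * (I k - ρ - a - 4 * δ))) * Real.exp (n * (a + 2 * δ))) := by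
            rw [Real.exp_add, Real.exp_add, Real.exp_sum]
        _ ≤ _ := by
            refine mul_le_mul_of_nonneg_left ?_ (Real.exp_pos _).le
            refine mul_le_mul ?_ hL2 (Real.exp_pos _).le (Finset.prod_nonneg fun _ _ => Nat.cast_nonneg _)
            exact Finset.prod_le_prod (fun _ _ => (Real.exp_pos _).le) (fun k _ => hJ2 k)
    have := Finset.sum_le_card_nsmul _ _ _ this
    simpa using this
  gcongr

lemma pmf_sum_one {A : Type*} [Fintype A] (P : PMF A) : ∑ a, (P a).toReal = 1 := by
  rw [← ENNReal.toReal_sum (fun a _ => P.apply_ne_top a)]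
  have := P.tsum_coe
  rw [tsum_fintype] at this
  rw [this]; rfl

/-- New lower bound (Theorem 3) for the compound DMC with `K` components and
states known non-causally at the transmitter only: for any conditional input
distribution `P : 𝒮 → PMF (𝒳 × 𝒰 × Π k, 𝒱 k)` the rate
`max(0, min_{∅ ≠ 𝒦 ⊆ {1,…,K}} (1/|𝒦|)[ Σ_{k∈𝒦} I(U,V_k;Y_k) − |𝒦|·I(U;S)
  + H((V_t)_{t∈𝒦} | U,S) − Σ_{k∈𝒦} H(V_k|U) ])`
is achievable.  Here `I(U,V_k;Y_k)` is computed from the joint pmf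
`p_k(u,v,s,x,y) = P_S(s)·P(s)(x,u,v)·(W k x s)(y)`, and all quantities not
involving `Y` are computed from the common marginal of the `p_k` on
`(u,v,s,x)`, namely `(u,v,s,x) ↦ P_S(s)·P(s)(x,u,v)`. -/
theorem K_component_lower_bound
    {K : ℕ} (hK : 1 ≤ K) {𝒰 : Type} [Fintype 𝒰] [Nonempty 𝒰]
    {𝒱 : Fin K → Type} [∀ k, Fintype (𝒱 k)] [∀ k, Nonempty (𝒱 k)]
    [∀ k, DecidableEq (𝒱 k)]
    (W : Fin K → 𝒳 → 𝒮 → PMF 𝒴) (PS : PMF 𝒮)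
    (P : 𝒮 → PMF (𝒳 × 𝒰 × (∀ k, 𝒱 k))) :
    -- the common marginal of the `p_k` on `(u, v, s, x)`
    let p₀ : 𝒰 × (∀ k, 𝒱 k) × 𝒮 × 𝒳 → ℝ := fun q =>
      (PS q.2.2.1).toReal * ((P q.2.2.1) (q.2.2.2, q.1, q.2.1)).toReal;
    -- `I(U,V_k;Y_k)` computed from `p_k`
    let IUVY : Fin K → ℝ := fun k =>
      mutualInfo (fun q : (𝒰 × 𝒱 k) × 𝒴 =>
        ∑ v : ∀ j, 𝒱 j, ∑ s : 𝒮, ∑ x : 𝒳,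
          if v k = q.1.2 then
            (PS s).toReal * ((P s) (x, q.1.1, v)).toReal * ((W k x s) q.2).toReal
          else 0);
    -- `I(U;S)`
    let IUS : ℝ :=
      mutualInfo (fun q : 𝒰 × 𝒮 =>
        ∑ v : ∀ j, 𝒱 j, ∑ x : 𝒳, p₀ (q.1, v, q.2, x));
    -- `H(V_k | U)`
    let HVU : Fin K → ℝ := fun k =>
      condEntropy (fun q : 𝒱 k × 𝒰 =>
        ∑ v : ∀ j, 𝒱 j, ∑ s : 𝒮, ∑ x : 𝒳,
          if v k = q.1 then p₀ (q.2, v, s, x) else 0);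
    -- `H((V_t)_{t∈𝒦} | U, S)`
    let Htuple : (𝒦 : Finset (Fin K)) → ℝ := fun 𝒦 =>
      condEntropy (fun q : ((t : {k : Fin K // k ∈ 𝒦}) → 𝒱 t.1) × (𝒰 × 𝒮) =>
        ∑ v : ∀ j, 𝒱 j, ∑ x : 𝒳,
          if ∀ t : {k : Fin K // k ∈ 𝒦}, v t.1 = q.1 t then
            p₀ (q.2.1, v, q.2.2, x)
          else 0);
    IsAchievable W PS
      (max 0 ((Finset.univ.powerset.erase ∅).inf'
        (by
          haveI : Nonempty (Fin K) := ⟨⟨0, hK⟩⟩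
          exact ⟨Finset.univ,
            Finset.mem_erase.mpr ⟨Finset.univ_nonempty.ne_empty, Finset.mem_powerset_self _⟩⟩)
        (fun 𝒦 =>
          (1 / (𝒦.card : ℝ)) *
            (∑ k ∈ 𝒦, IUVY k - (𝒦.card : ℝ) * IUS + Htuple 𝒦 - ∑ k ∈ 𝒦, HVU k)))) := by
  intro p₀ IUVY IUS HVU Htuple
  obtain ⟨p, hpd⟩ : ∃ p : 𝒮 → 𝒰 → (∀ k, 𝒱 k) → 𝒳 → ℝ,
    p = fun s u v x => (PS s).toReal * ((P s) (x, u, v)).toReal := ⟨_, rfl⟩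
  have hp0 : ∀ s u v x, 0 ≤ p s u v x := fun s u v x => by rw [hpd]; positivity
  have hPS : ∀ s, ∑ u, ∑ v, ∑ x, p s u v x = (PS s).toReal := by
    intro s
    rw [hpd]
    simp_rw [← Finset.mul_sum]
    have h1 := pmf_sum_one (P s)
    rw [Fintype.sum_prod_type, Finset.sum_comm, Fintype.sum_prod_type] at h1
    have h2 : ∑ u, ∑ v, ∑ x, ((P s) (x, u, v)).toReal = 1 := h1
    rw [h2, mul_one]
  have hPS1 := pmf_sum_one PS
  have hp1 : ∑ s, ∑ u, ∑ v, ∑ x, p s u v x = 1 := by simp_rw [hPS, hPS1]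
  obtain ⟨Wr, hWd⟩ : ∃ Wr : Fin K → 𝒳 → 𝒮 → 𝒴 → ℝ,
    Wr = fun k x s y => ((W k x s) y).toReal := ⟨_, rfl⟩
  have hW0 : ∀ k x s y, 0 ≤ Wr k x s y := fun k x s y => by rw [hWd]; positivity
  have hW1 : ∀ k x s, ∑ y, Wr k x s y = 1 := fun k x s => by rw [hWd]; exact pmf_sum_one _
  obtain ⟨s₀, _⟩ := PS.support_nonempty
  obtain ⟨t₀, _⟩ := (P s₀).support_nonempty
  haveI : Nonempty 𝒳 := ⟨t₀.1⟩
  have hη := rr_eta p hp0 (fun s => (PS s).toReal) hPS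
  have hI := rp_I p Wr
  have hIUS := IUS_nonneg p hp0 (fun s => (PS s).toReal) hPS hPS1
  have hH := H_cond p hp0 hp1
  have hemp := Htuple_E p ∅
  have hemp' : - ∑ s, ∑ u, ∑ v, ∑ x, p s u v x * Real.log (mB p ∅ s u v / ∑ v, ∑ x, p s u v x) = 0 := by
    rw [neg_eq_zero]
    refine Finset.sum_eq_zero fun s _ => Finset.sum_eq_zero fun u _ => Finset.sum_eq_zero fun v _ =>
      Finset.sum_eq_zero fun x _ => ?_
    have : mB p ∅ s u v = ∑ v, ∑ x, p s u v x := by simp [mB]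
    rw [this]
    by_cases h : ∑ v, ∑ x, p s u v x = 0
    · simp [h]
    · rw [div_self h]; simp
  rw [hemp'] at hemp
  have eIUS : mutualInfo (fun q : 𝒰 × 𝒮 => ∑ v : ∀ j, 𝒱 j, ∑ x : 𝒳, p q.2 q.1 v x) = IUS := by
    rw [hpd]
  have eHVU : ∀ k, condEntropy (fun q : 𝒱 k × 𝒰 =>
        ∑ v : ∀ j, 𝒱 j, ∑ s, ∑ x, if v k = q.1 then p s q.2 v x else 0) = HVU k := by
    rw [hpd]; intro k; rfl
  have eHt : ∀ 𝒦 : Finset (Fin K), condEntropy (fun q : ((t : {k : Fin K // k ∈ 𝒦}) → 𝒱 t.1) × (𝒰 × 𝒮) =>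
        ∑ v : ∀ j, 𝒱 j, ∑ x : 𝒳,
          if ∀ t : {k : Fin K // k ∈ 𝒦}, v t.1 = q.1 t then p q.2.2 q.2.1 v x else 0) = Htuple 𝒦 := by
    rw [hpd]; intro 𝒦; rfl
  have eI : ∀ k, mutualInfo (fun q : (𝒰 × 𝒱 k) × 𝒴 => ∑ v : ∀ j, 𝒱 j, ∑ s, ∑ x,
      if v k = q.1.2 then p s q.1.1 v x * Wr k x s q.2 else 0) = IUVY k := by
    rw [hpd, hWd]; intro k; rfl
  simp_rw [eIUS, eHVU, eHt] at hη
  simp_rw [eI] at hI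
  rw [eIUS] at hIUS
  simp_rw [eHt, eHVU] at hH
  rw [eHt] at hemp
  clear_value IUVY IUS HVU Htuple
  refine ⟨le_max_left _ _, fun ε hε γ hγ => ?_⟩
  suffices key : ∀ R : ℝ, (∀ 𝒦 : Finset (Fin K), 𝒦.Nonempty → (𝒦.card : ℝ) * R ≤
      ∑ k ∈ 𝒦, IUVY k - (𝒦.card : ℝ) * IUS + Htuple 𝒦 - ∑ k ∈ 𝒦, HVU k) →
      ∃ n₀ : ℕ, ∀ n ≥ n₀, ∃ M : ℕ, 1 ≤ M ∧
        ∃ (φ : Fin M → (Fin n → 𝒮) → (Fin n → 𝒳)) (ψ : (Fin n → 𝒴) → Fin M),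
          Real.log M / n ≥ max 0 R - γ ∧ ∀ m θ, avgError W PS φ ψ m θ ≤ ε by
    refine key _ ?_
    intro 𝒦 h𝒦
    have hc : (0:ℝ) < 𝒦.card := by exact_mod_cast h𝒦.card_pos
    have hmem : 𝒦 ∈ (Finset.univ.powerset.erase ∅ : Finset (Finset (Fin K))) :=
      Finset.mem_erase.2 ⟨h𝒦.ne_empty, Finset.mem_powerset.2 (Finset.subset_univ _)⟩
    have h1 := Finset.inf'_le (fun 𝒦 : Finset (Fin K) => (1 / (𝒦.card : ℝ)) *
            (∑ k ∈ 𝒦, IUVY k - (𝒦.card : ℝ) * IUS + Htuple 𝒦 - ∑ k ∈ 𝒦, HVU k)) hmem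
    have h2 := mul_le_mul_of_nonneg_left h1 hc.le
    rwa [← mul_assoc, mul_one_div_cancel hc.ne', one_mul] at h2
  intro R hR
  by_cases hRγ : R ≤ γ
  · refine ⟨0, fun n _ => ⟨1, le_refl _, fun _ _ _ => Classical.arbitrary _, fun _ => 0, ?_, ?_⟩⟩
    · have : max 0 R ≤ γ := max_le hγ.1.le hRγ
      simp only [Nat.cast_one, Real.log_one, zero_div, ge_iff_le]
      linarith
    · intro m θ
      have : ∀ y : Fin n → 𝒴, ¬ ((0 : Fin 1) ≠ m) := fun _ h => h (Subsingleton.elim _ _)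
      unfold avgError
      rw [Finset.sum_eq_zero]
      · exact hε.1.le
      · intro s _
        rw [Finset.sum_eq_zero, mul_zero]
        intro y _
        rw [if_neg (this y), mul_zero]
  · push Not at hRγ
    have hRpos : 0 < R := lt_trans hγ.1 hRγ
    rw [max_eq_right hRpos.le]
    have hδ : 0 < γ / 4 := by linarith [hγ.1]
    have hT : ∀ k, 0 ≤ IUVY k - (R - γ) - IUS - 4 * (γ / 4) := by
      intro k
      have h1 := hR {k} ⟨k, Finset.mem_singleton_self k⟩
      have h2 := hH k
      simp only [Finset.card_singleton, Finset.sum_singleton, Nat.cast_one, one_mul] at h1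
      linarith
    have hη' : ∀ 𝒦 : Finset (Fin K), IUS + ∑ k ∈ 𝒦, HVU k - Htuple 𝒦 ≤
        IUS + ∑ k ∈ 𝒦, (IUVY k - (R - γ) - IUS - 4 * (γ / 4)) := by
      intro 𝒦
      rcases 𝒦.eq_empty_or_nonempty with h | h
      · subst h; simp [hemp]
      · have h1 := hR 𝒦 h
        have h2 : ∑ k ∈ 𝒦, (IUVY k - (R - γ) - IUS - 4 * (γ / 4)) =
            ∑ k ∈ 𝒦, IUVY k - 𝒦.card * R - 𝒦.card * IUS := by
          have : ∀ k, IUVY k - (R - γ) - IUS - 4 * (γ / 4) = IUVY k - R - IUS := fun k => by ring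
          simp_rw [this, Finset.sum_sub_distrib, Finset.sum_const, nsmul_eq_mul]
        rw [h2]; linarith
    obtain ⟨C, hC⟩ := n_shot' p Wr hp0 (fun s => (PS s).toReal) hPS hPS1 hW0 hW1 _ hη IUVY hI (γ / 4) hδ
    obtain ⟨c, hc, n₀, hn₀⟩ := rate_bound hK _ IUVY IUS (R - γ) (γ / 4) C ε hIUS (by linarith) hδ hε.1 hT hη'
    refine ⟨max n₀ 1, fun n hn => ?_⟩
    have hn1 : 0 < n := lt_of_lt_of_le Nat.one_pos (le_trans (le_max_right _ _) hn)
    have hB := hn₀ n (le_trans (le_max_left _ _) hn)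
    have hMpos : 0 < ⌈Real.exp (n * (R - γ))⌉₊ := Nat.ceil_pos.2 (Real.exp_pos _)
    obtain ⟨φ, ψ, hφ⟩ := hC n hn1 ⌈Real.exp (n * (IUS + 2 * (γ / 4)))⌉₊ (Nat.ceil_pos.2 (Real.exp_pos _))
      (fun k => ⌈Real.exp (n * (IUVY k - (R - γ) - IUS - 4 * (γ / 4)))⌉₊) (fun k => Nat.ceil_pos.2 (Real.exp_pos _))
      c hc (2 * ⌈Real.exp (n * (R - γ))⌉₊) (by omega)
    have hlogM : R - γ ≤ Real.log (⌈Real.exp (n * (R - γ))⌉₊ : ℝ) / n := by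
      have hnr : (0:ℝ) < n := by exact_mod_cast hn1
      rw [le_div_iff₀ hnr, mul_comm, Real.le_log_iff_exp_le (by exact_mod_cast hMpos)]
      exact Nat.le_ceil _
    have hφ' := hφ.trans (mul_le_mul_of_nonneg_left hB (Nat.cast_nonneg _))
    clear hφ hB hC hn₀
    generalize ⌈Real.exp (n * (R - γ))⌉₊ = M at *
    have hterm : ∀ m k, 0 ≤ avgError W PS φ ψ m k := fun m k =>
      Finset.sum_nonneg fun s _ => mul_nonneg (Finset.prod_nonneg fun _ _ => ENNReal.toReal_nonneg)
        (Finset.sum_nonneg fun y _ => mul_nonneg (Finset.prod_nonneg fun _ _ => ENNReal.toReal_nonneg)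
          (by split_ifs <;> norm_num))
    have hsum : ∑ m, ∑ k, avgError W PS φ ψ m k ≤ (2 * M : ℕ) * (ε / 2) := by
      refine le_trans (le_of_eq ?_) hφ'
      subst hWd
      refine Finset.sum_congr rfl fun m _ => Finset.sum_congr rfl fun k _ => ?_
      unfold avgError
      refine Finset.sum_congr rfl fun s _ => ?_
      congr 1
    obtain ⟨e, he, hle⟩ := expurg (fun m => ∑ k, avgError W PS φ ψ m k)
      (fun m => Finset.sum_nonneg fun k _ => hterm m k) ε hε.1 hsum
    haveI : NeZero M := ⟨hMpos.ne'⟩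
    haveI : Nonempty (Fin M) := ⟨0⟩
    refine ⟨M, hMpos, fun m => φ (e m), fun y => Function.invFun e (ψ y), hlogM, fun m θ => ?_⟩
    refine le_trans ?_ (hle m)
    refine le_trans ?_ (Finset.single_le_sum (f := fun k => avgError W PS φ ψ (e m) k)
      (fun k _ => hterm (e m) k) (Finset.mem_univ θ))
    unfold avgError
    refine Finset.sum_le_sum fun s _ => mul_le_mul_of_nonneg_left ?_
      (Finset.prod_nonneg fun _ _ => ENNReal.toReal_nonneg)
    refine Finset.sum_le_sum fun y _ => mul_le_mul_of_nonneg_left ?_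
      (Finset.prod_nonneg fun _ _ => ENNReal.toReal_nonneg)
    by_cases h : ψ y = e m
    · have h2 : Function.invFun e (ψ y) = m := by rw [h]; exact Function.leftInverse_invFun he m
      rw [if_neg (not_not.2 h2), if_neg (not_not.2 h)]
    · rw [if_pos h]
      split_ifs <;> norm_num

end CompoundK
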